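/- arXiv:2311.12554 — 3 statements merged into one kernel-verified Lean document; each statement's English description precedes it below -/
import Mathlib

section
/- Let f : [0,1] → ℝ be the restriction to [0,1] of an Ω-bandlimited function with spectral measure μ, let Δ > 0, let K ≥ 2 be an integer, and let T be the quantized tensor representation of f on D_K. Set N_k := ⌈2^{−k}Ω + Δ⌉ for k = 1,…,K−1, and define the matrix product state S(σ_{1:K}) := Σ A_L^{1,α_1}(σ_1) A_2^{α_1 α_2}(σ_2) ⋯ A_{K−1}^{α_{K−2} α_{K−1}}(σ_{K−1}) A_R^{α_{K−1}}(σ_K), where the sum runs over α_k ∈ {0,…,N_k}, the cores are A_L^{1,β}(σ) := f((σ + c_{N_1}^β)/2), A_k^{αβ}(σ) := P_{N_{k−1}}^α((σ + c_{N_k}^β)/2) for k = 2,…,K−1, and A_R^{α}(σ) := P_{N_{K−1}}^α(σ/2). Then max_{σ_{1:K}} |T(σ_{1:K}) − S(σ_{1:K})| ≤ (2/π)·|μ|·(K−1)·[1 + (2/π)·log(⌈Ω/2 + Δ⌉ + 1)]^{K−2}·e^{−Δ/2}. -/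
noncomputable section

/-- The Chebyshev–Lobatto node `c_N^α = (cos(πα/N)+1)/2`, shifted and scaled to `[0,1]`. -/
def chebNode (N α : ℕ) : ℝ := (Real.cos (Real.pi * α / N) + 1) / 2

/-- The Lagrange cardinal polynomial `P_N^α` for the Chebyshev–Lobatto grid. -/
def chebP (N α : ℕ) (x : ℝ) : ℝ :=
  ∏ β ∈ (Finset.range (N + 1)).erase α,
    (x - chebNode N β) / (chebNode N α - chebNode N β)

/-- The real value of a bit. -/
def bitVal (b : Bool) : ℝ := if b then 1 else 0

/-- The quantized tensor representation of `f` on the dyadic grid `D_K`. -/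
def qtt (f : ℝ → ℝ) (K : ℕ) (σ : Fin K → Bool) : ℝ :=
  f (∑ k : Fin K, (2 : ℝ) ^ (-(k.val + 1 : ℤ)) * bitVal (σ k))

/-- The total variation `|μ|` of a finite signed measure. -/
def tv (μ : MeasureTheory.SignedMeasure ℝ) : ℝ :=
  (μ.totalVariation Set.univ).toReal

/-- The integral of a complex-valued function against a signed measure, via the
Jordan decomposition `μ = μ⁺ - μ⁻`. -/
def sintegral (μ : MeasureTheory.SignedMeasure ℝ) (g : ℝ → ℂ) : ℂ :=
  (∫ ω, g ω ∂μ.toJordanDecomposition.posPart) -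
    ∫ ω, g ω ∂μ.toJordanDecomposition.negPart

/-- `g : ℝ → ℝ` is `Ω`-bandlimited with spectral measure `μ`. -/
def IsBandlimited (Ω : ℝ) (μ : MeasureTheory.SignedMeasure ℝ) (g : ℝ → ℝ) : Prop :=
  μ.totalVariation (Set.Icc (-Ω) Ω)ᶜ = 0 ∧
    ∀ x : ℝ, (g x : ℂ) =
      (1 / (2 * (Real.pi : ℂ))) *
        sintegral μ (fun ω => Complex.exp (Complex.I * (ω : ℂ) * (x : ℂ)))

/-- Partial products `W_k = A_L A_2 ⋯ A_k` of the decaying-rank interpolative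
construction, with level-dependent grid sizes `N_k`: `Wcore f Nk k` corresponds to
`W_{k+1}`, i.e. it uses bits `σ_1,…,σ_{k+1}` and its column index `β` runs over the
Chebyshev–Lobatto grid of size `N_{k+1} + 1`. -/
def Wcore (f : ℝ → ℝ) (Nk : ℕ → ℕ) : (k : ℕ) → (Fin (k + 1) → Bool) → ℕ → ℝ
  | 0, σ, β => f ((bitVal (σ 0) + chebNode (Nk 1) β) / 2)
  | k + 1, σ, β => ∑ γ ∈ Finset.range (Nk (k + 1) + 1),
      Wcore f Nk k (fun i => σ i.castSucc) γ *
        chebP (Nk (k + 1)) γ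
          ((bitVal (σ (Fin.last (k + 1))) + chebNode (Nk (k + 2)) β) / 2)

section
open Finset

/-- Comparison of two chords of the sine: `sin (n x) / sin x` is antitone. -/
lemma sin_mul_sin_natMul_le {x y : ℝ} (hx : 0 ≤ x) (hxy : x ≤ y) (n : ℕ)
    (hny : n * y ≤ Real.pi / 2) (hy : y ≤ Real.pi / 2) :
    Real.sin (n * y) * Real.sin x ≤ Real.sin (n * x) * Real.sin y := by
  have hpi := Real.pi_pos
  induction n with
  | zero => simp
  | succ n ih =>
    push_cast at hny ⊢
    have hny' : n * y ≤ Real.pi / 2 := by nlinarith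
    have h0 : (0 : ℝ) ≤ n := n.cast_nonneg
    have ih := ih hny'
    have hsx : 0 ≤ Real.sin x := Real.sin_nonneg_of_nonneg_of_le_pi hx (by linarith)
    have hsy : 0 ≤ Real.sin y := Real.sin_nonneg_of_nonneg_of_le_pi (hx.trans hxy) (by linarith)
    have hsny : 0 ≤ Real.sin (n * y) :=
      Real.sin_nonneg_of_nonneg_of_le_pi (mul_nonneg h0 (hx.trans hxy)) (by linarith)
    have hcxy : Real.cos y ≤ Real.cos x := Real.cos_le_cos_of_nonneg_of_le_pi hx (by linarith) hxy
    have hcx : 0 ≤ Real.cos x := Real.cos_nonneg_of_mem_Icc ⟨by linarith, by linarith⟩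
    have hcn : Real.cos (n * y) ≤ Real.cos (n * x) :=
      Real.cos_le_cos_of_nonneg_of_le_pi (mul_nonneg h0 hx) (by linarith)
        (mul_le_mul_of_nonneg_left hxy h0)
    rw [add_one_mul, add_one_mul, Real.sin_add, Real.sin_add]
    have e1 := mul_le_mul_of_nonneg_right ih hcx
    have e2 := mul_le_mul_of_nonneg_left hcxy (mul_nonneg hsny hsx)
    have e3 := mul_le_mul_of_nonneg_right hcn (mul_nonneg hsx hsy)
    nlinarith

/-- The sum of two cotangents damped by `cos (n δ)` is largest when the two arguments agree. -/
lemma cos_mul_cot_add_cot_le {n : ℕ} (hn : 1 ≤ n) {s δ : ℝ}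
    (hs : Real.pi / (4 * n) ≤ s) (hs' : s < Real.pi / 2) (hδ : 0 ≤ δ)
    (hδn : δ < Real.pi / (4 * n)) :
    Real.cos (n * (2 * δ)) * (Real.cot (s - δ) + Real.cot (s + δ)) ≤ 2 * Real.cot s := by
  have hpi := Real.pi_pos
  have hn0 : (1 : ℝ) ≤ n := by exact_mod_cast hn
  set y := Real.pi / (4 * n) with hy
  have hny : n * y = Real.pi / 4 := by rw [hy]; field_simp
  have hyp : y ≤ Real.pi / 2 := by nlinarith [hδ.trans hδn.le]
  have key := sin_mul_sin_natMul_le hδ hδn.le n (by linarith) hyp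
  rw [hny, Real.sin_pi_div_four] at key
  have hsδ : 0 ≤ Real.sin δ := Real.sin_nonneg_of_nonneg_of_le_pi hδ (by linarith)
  have hsn : 0 ≤ Real.sin (n * δ) := by
    apply Real.sin_nonneg_of_nonneg_of_le_pi (by positivity)
    nlinarith
  have hsy : Real.sin y ≤ Real.sin s :=
    Real.sin_le_sin_of_le_of_le_pi_div_two (by linarith) hs'.le hs
  have hss : 0 < Real.sin s := Real.sin_pos_of_pos_of_lt_pi (by linarith) (by linarith)
  have hcs : 0 < Real.cos s := Real.cos_pos_of_mem_Ioo ⟨by linarith, by linarith⟩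
  have key2 : Real.sin δ ^ 2 ≤ 2 * Real.sin (n * δ) ^ 2 * Real.sin s ^ 2 := by
    have h1 : Real.sin (n * δ) * Real.sin y ≤ Real.sin (n * δ) * Real.sin s :=
      mul_le_mul_of_nonneg_left hsy hsn
    have h2 : √2 / 2 * Real.sin δ ≤ Real.sin (n * δ) * Real.sin s := key.trans h1
    have h3 := pow_le_pow_left₀ (by positivity) h2 2
    have h4 : √2 ^ 2 = 2 := Real.sq_sqrt (by norm_num)
    have h5 : (√2 / 2 * Real.sin δ) ^ 2 = Real.sin δ ^ 2 / 2 := by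
      rw [mul_pow, div_pow, h4]; ring
    rw [h5] at h3
    nlinarith
  have ha : 0 < Real.sin (s - δ) := Real.sin_pos_of_pos_of_lt_pi (by linarith) (by linarith)
  have hb : 0 < Real.sin (s + δ) := Real.sin_pos_of_pos_of_lt_pi (by linarith) (by linarith)
  have hprod : Real.sin (s - δ) * Real.sin (s + δ) = Real.sin s ^ 2 - Real.sin δ ^ 2 := by
    rw [Real.sin_sub, Real.sin_add]
    nlinarith [Real.sin_sq_add_cos_sq s, Real.sin_sq_add_cos_sq δ]
  have hcot : Real.cot (s - δ) + Real.cot (s + δ)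
      = 2 * Real.sin s * Real.cos s / (Real.sin (s - δ) * Real.sin (s + δ)) := by
    rw [Real.cot_eq_cos_div_sin, Real.cot_eq_cos_div_sin, div_add_div _ _ ha.ne' hb.ne']
    congr 1
    have := Real.sin_add (s - δ) (s + δ)
    rw [← Real.sin_two_mul, show 2 * s = s - δ + (s + δ) by ring, this]
    ring
  have hcos : Real.cos (n * (2 * δ)) = 1 - 2 * Real.sin (n * δ) ^ 2 := by
    rw [show (n : ℝ) * (2 * δ) = 2 * (n * δ) by ring, Real.cos_two_mul, Real.cos_sq']; ring
  rw [hcot, hcos, Real.cot_eq_cos_div_sin, mul_div_assoc', mul_div_assoc',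
    div_le_div_iff₀ (by positivity) hss, hprod]
  have : (1 - 2 * Real.sin (n * δ) ^ 2) * Real.sin s ^ 2 ≤ Real.sin s ^ 2 - Real.sin δ ^ 2 := by
    nlinarith
  nlinarith [mul_le_mul_of_nonneg_left this hcs.le]

/-- The first two terms of the Laurent expansion of the cotangent bound it from above. -/
lemma cot_le_inv_sub {x : ℝ} (hx : 0 < x) (hx' : x < Real.pi / 2) :
    Real.cot x ≤ 1 / x - x / 3 := by
  have hs : 0 < Real.sin x := Real.sin_pos_of_pos_of_lt_pi hx (by linarith [Real.pi_pos])
  have hmono : MonotoneOn (fun t : ℝ => (1 - t ^ 2 / 3) * Real.sin t - t * Real.cos t)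
      (Set.Icc 0 x) := by
    have hd : ∀ t : ℝ, HasDerivAt (fun t : ℝ => (1 - t ^ 2 / 3) * Real.sin t - t * Real.cos t)
        (t / 3 * (Real.sin t - t * Real.cos t)) t := by
      intro t
      have h1 := ((((hasDerivAt_id t).pow 2).div_const 3).const_sub 1).mul (Real.hasDerivAt_sin t)
      have h2 := (hasDerivAt_id t).mul (Real.hasDerivAt_cos t)
      refine (h1.sub h2).congr_deriv ?_
      simp only [id, Pi.pow_apply]
      push_cast
      ring
    apply monotoneOn_of_deriv_nonneg (convex_Icc _ _)
    · exact fun t _ => (hd t).continuousAt.continuousWithinAt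
    · exact fun t _ => (hd t).differentiableAt.differentiableWithinAt
    · intro t ht
      rw [interior_Icc] at ht
      rw [(hd t).deriv]
      have hc : 0 < Real.cos t :=
        Real.cos_pos_of_mem_Ioo ⟨by linarith [ht.1, Real.pi_pos], by linarith [ht.2]⟩
      have htan := Real.lt_tan ht.1 (by linarith [ht.2])
      rw [Real.tan_eq_sin_div_cos, lt_div_iff₀ hc] at htan
      exact mul_nonneg (by linarith [ht.1]) (by linarith)
  have h0 := hmono (Set.left_mem_Icc.2 hx.le) (Set.right_mem_Icc.2 hx.le) hx.le
  simp only [Real.sin_zero, mul_zero, zero_mul, sub_zero] at h0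
  rw [Real.cot_eq_cos_div_sin, div_le_iff₀ hs, ← sub_nonneg]
  have : (1 / x - x / 3) * Real.sin x - Real.cos x
      = ((1 - x ^ 2 / 3) * Real.sin x - x * Real.cos x) / x := by
    field_simp
  rw [this]
  positivity

/-- Odd harmonic numbers, starting from the second term. -/
lemma sum_inv_odd_le (n : ℕ) :
    ∑ m ∈ range (n + 2), 1 / (2 * (m : ℝ) + 1)
      ≤ 4 / 3 + (Real.log (n + 2) - Real.log 2) / 2 := by
  induction n with
  | zero => norm_num [sum_range_succ]
  | succ n ih =>
    rw [sum_range_succ]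
    have hn : (0 : ℝ) ≤ n := n.cast_nonneg
    have hlog : 2 / (2 * ((n : ℝ) + 2) + 1) ≤ Real.log (n + 3) - Real.log (n + 2) := by
      have h := Real.hasSum_log_one_add_inv (a := (n : ℝ) + 2) (by positivity)
      have h0 := h.summable.sum_le_tsum (range 1) (fun i _ => by positivity)
      rw [h.tsum_eq] at h0
      rw [← Real.log_div (by positivity) (by positivity)]
      have e0 : 1 + ((n : ℝ) + 2)⁻¹ = (n + 3) / (n + 2) := by field_simp; ring
      rw [sum_range_one, e0] at h0
      refine le_trans (le_of_eq ?_) h0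
      simp
      ring
    push_cast
    have e : 1 / (2 * ((n : ℝ) + 2) + 1) = 2 / (2 * ((n : ℝ) + 2) + 1) / 2 := by ring
    rw [show (n : ℝ) + 1 + 2 = n + 3 by ring, e]
    linarith

/-- Upper bound for the trigonometric Lebesgue constant. -/
lemma sum_cot_le {n : ℕ} (hn : 1 ≤ n) :
    (1 / (n : ℝ)) * ∑ m ∈ range n, Real.cot ((2 * m + 1) * (Real.pi / (4 * n)))
      ≤ 1 + (2 / Real.pi) * Real.log (n + 1) := by
  have hpi := Real.pi_pos
  have hpi3 := Real.pi_gt_d2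
  have hn0 : (1 : ℝ) ≤ n := by exact_mod_cast hn
  have hterm : ∀ m ∈ range n, Real.cot ((2 * m + 1) * (Real.pi / (4 * n)))
      ≤ 4 * n / Real.pi * (1 / (2 * (m : ℝ) + 1)) - Real.pi / (12 * n) * (2 * m + 1) := by
    intro m hm
    have hm' : (m : ℝ) + 1 ≤ n := by exact_mod_cast mem_range.1 hm
    refine (cot_le_inv_sub (by positivity) ?_).trans_eq ?_
    · rw [mul_div_assoc', div_lt_div_iff₀ (by positivity) (by norm_num)]
      nlinarith
    · field_simp
      ring
  have hodd : ∀ k : ℕ, ∑ m ∈ range k, (2 * (m : ℝ) + 1) = k ^ 2 := by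
    intro k
    induction k with
    | zero => simp
    | succ k ih => rw [sum_range_succ, ih]; push_cast; ring
  have hsum := sum_le_sum hterm
  rw [sum_sub_distrib, ← mul_sum, ← mul_sum, hodd] at hsum
  have hharm : ∑ m ∈ range n, 1 / (2 * (m : ℝ) + 1)
      ≤ Real.pi / 4 + Real.pi ^ 2 / 48 + Real.log (n + 1) / 2 := by
    have hl2 := Real.log_two_gt_d9
    obtain rfl | ⟨k, rfl⟩ : n = 1 ∨ ∃ k, n = k + 2 := by
      rcases n with _ | _ | k
      · omega
      · simp
      · exact Or.inr ⟨k, rfl⟩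
    · norm_num
      nlinarith
    · have h1 := sum_inv_odd_le k
      have h2 : Real.log (k + 2) ≤ Real.log (k + 2 + 1) :=
        Real.log_le_log (by positivity) (by linarith)
      push_cast
      nlinarith
  calc _ ≤ (1 / (n : ℝ)) * (4 * n / Real.pi * (Real.pi / 4 + Real.pi ^ 2 / 48
        + Real.log (n + 1) / 2) - Real.pi / (12 * n) * n ^ 2) := by
        gcongr
        refine hsum.trans ?_
        gcongr
    _ = _ := by field_simp; ring

open Polynomial

lemma chebyshevNode_injOn (N : ℕ) :
    Set.InjOn (Polynomial.Chebyshev.node N) (range (N + 1) : Finset ℕ) := by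
  have := (Polynomial.Chebyshev.strictAntiOn_node N).injOn
  refine this.mono ?_
  intro i hi
  simp at hi ⊢
  omega

lemma chebNode_eq (N α : ℕ) : chebNode N α = (Polynomial.Chebyshev.node N α + 1) / 2 := by
  rw [chebNode, Polynomial.Chebyshev.node, mul_comm Real.pi]

lemma chebP_eq_eval_basis (N α : ℕ) (x : ℝ) :
    chebP N α x =
      (Lagrange.basis (range (N + 1)) (Polynomial.Chebyshev.node N) α).eval (2 * x - 1) := by
  rw [chebP, Lagrange.basis, eval_prod]
  refine prod_congr rfl fun β _ => ?_
  rw [Lagrange.basisDivisor, chebNode_eq, chebNode_eq]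
  simp only [eval_mul, eval_C, eval_sub, eval_X]
  rw [div_eq_mul_inv, mul_comm, ← sub_div, add_sub_add_right_eq_sub, inv_div, div_eq_mul_inv,
    add_div]
  ring

/-- The polynomial `(1 - X²) U_{N-1}` vanishing at the Chebyshev-Lobatto nodes. -/
def lobattoPoly (N : ℕ) : ℝ[X] := (1 - X ^ 2) * Chebyshev.U ℝ (N - 1 : ℕ)

lemma eval_lobattoPoly_cos {N : ℕ} (hN : 1 ≤ N) (θ : ℝ) :
    (lobattoPoly N).eval (Real.cos θ) = Real.sin θ * Real.sin (N * θ) := by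
  have h := Chebyshev.U_real_cos θ ((N - 1 : ℕ) : ℤ)
  have hc : (((N - 1 : ℕ) : ℤ) : ℝ) + 1 = N := by
    have : (N - 1 : ℕ) + 1 = N := by omega
    exact_mod_cast this
  rw [hc] at h
  simp only [lobattoPoly, eval_mul, eval_sub, eval_one, eval_pow, eval_X]
  rw [← h, ← Real.sin_sq]
  ring

lemma node_eq_cos (N α : ℕ) : Chebyshev.node N α = Real.cos (α * (Real.pi / N)) := by
  rw [Chebyshev.node, mul_div_assoc]

lemma eval_lobattoPoly_node {N : ℕ} (hN : 1 ≤ N) (α : ℕ) :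
    (lobattoPoly N).eval (Chebyshev.node N α) = 0 := by
  have hN0 : (N : ℝ) ≠ 0 := by exact_mod_cast (by omega : N ≠ 0)
  rw [node_eq_cos, eval_lobattoPoly_cos hN,
    show (N : ℝ) * (α * (Real.pi / N)) = α * Real.pi by field_simp, Real.sin_nat_mul_pi, mul_zero]

lemma degree_one_sub_X_sq : (1 - X ^ 2 : ℝ[X]).degree = 2 := by
  compute_degree!

lemma degree_lobattoPoly {N : ℕ} (hN : 1 ≤ N) : (lobattoPoly N).degree = (N + 1 : ℕ) := by
  rw [lobattoPoly, degree_mul, degree_one_sub_X_sq, Chebyshev.degree_U_natCast]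
  have : N + 1 = 2 + (N - 1) := by omega
  rw [this]
  push_cast
  rfl

lemma leadingCoeff_lobattoPoly_ne_zero {N : ℕ} (hN : 1 ≤ N) :
    (lobattoPoly N).leadingCoeff ≠ 0 := by
  rw [Ne, leadingCoeff_eq_zero]
  intro h
  have := degree_lobattoPoly hN
  rw [h, degree_zero] at this
  exact WithBot.bot_ne_coe this

lemma lobattoPoly_eq_nodal {N : ℕ} (hN : 1 ≤ N) :
    lobattoPoly N = C (lobattoPoly N).leadingCoeff *
      Lagrange.nodal (range (N + 1)) (Chebyshev.node N) := by
  have h0 := leadingCoeff_lobattoPoly_ne_zero hN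
  refine Polynomial.eq_of_degree_le_of_eval_index_eq (range (N + 1))
    (chebyshevNode_injOn N) ?_ ?_ ?_ ?_
  · rw [degree_lobattoPoly hN, card_range]
  · rw [degree_lobattoPoly hN, degree_C_mul h0, Lagrange.degree_nodal, card_range]
  · rw [leadingCoeff_mul, leadingCoeff_C, Lagrange.nodal_monic.leadingCoeff, mul_one]
  · intro i hi
    rw [eval_lobattoPoly_node hN, eval_mul, Lagrange.eval_nodal_at_node hi, mul_zero]

lemma eval_basis_eq {N : ℕ} (hN : 1 ≤ N) {α : ℕ} (hα : α ∈ range (N + 1)) {x : ℝ}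
    (hx : x ≠ Chebyshev.node N α) :
    (Lagrange.basis (range (N + 1)) (Chebyshev.node N) α).eval x =
      (lobattoPoly N).eval x /
        ((derivative (lobattoPoly N)).eval (Chebyshev.node N α) * (x - Chebyshev.node N α)) := by
  have h0 := leadingCoeff_lobattoPoly_ne_zero hN
  rw [Lagrange.eval_basis_not_at_node hα hx, Lagrange.nodalWeight_eq_eval_derivative_nodal hα]
  conv_rhs => rw [lobattoPoly_eq_nodal hN]
  rw [derivative_C_mul, eval_mul, eval_mul, eval_C, eval_C, mul_assoc, mul_div_mul_left _ _ h0,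
    div_eq_mul_inv, mul_inv]

lemma natCast_mul_derivative_lobattoPoly {N : ℕ} (hN : 1 ≤ N) :
    (N : ℝ[X]) * derivative (lobattoPoly N)
      = -(N : ℝ[X]) *
        (X * Chebyshev.U ℝ ((N - 1 : ℕ) : ℤ) + (N : ℝ[X]) * Chebyshev.T ℝ (N : ℤ)) := by
  have hc : ((N - 1 : ℕ) : ℤ) = (N : ℤ) - 1 := by omega
  have hT := Chebyshev.T_derivative_eq_U (R := ℝ) N
  have h2 := Chebyshev.one_sub_X_sq_mul_derivative_derivative_T_eq_poly_in_T (R := ℝ) N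
  rw [Function.iterate_succ_apply, Function.iterate_one, hT] at h2
  rw [lobattoPoly, hc]
  simp only [derivative_mul, derivative_sub, derivative_one, derivative_X_pow,
    derivative_intCast] at h2 ⊢
  push_cast at h2 ⊢
  simp at h2 ⊢
  have hC : (C 2 : ℝ[X]) = 2 := map_ofNat C 2
  linear_combination h2 - (N : ℝ[X]) * X * Chebyshev.U ℝ ((N : ℤ) - 1) * hC

lemma abs_eval_derivative_lobattoPoly {N : ℕ} (hN : 1 ≤ N) {α : ℕ} (hα : α ≤ N) :
    |(derivative (lobattoPoly N)).eval (Chebyshev.node N α)|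
      = if α = 0 ∨ α = N then 2 * (N : ℝ) else N := by
  have hN0 : (N : ℝ) ≠ 0 := by exact_mod_cast (by omega : N ≠ 0)
  have h := congrArg (eval (Chebyshev.node N α)) (natCast_mul_derivative_lobattoPoly hN)
  simp only [eval_mul, eval_neg, eval_add, eval_natCast, eval_X] at h
  have h' : (derivative (lobattoPoly N)).eval (Chebyshev.node N α)
      = -(Chebyshev.node N α * (Chebyshev.U ℝ (N - 1 : ℕ)).eval (Chebyshev.node N α)
        + N * (Chebyshev.T ℝ N).eval (Chebyshev.node N α)) := by
    apply mul_left_cancel₀ hN0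
    rw [h]; ring
  have hc : (((N - 1 : ℕ) : ℤ) : ℝ) + 1 = N := by
    have : (N - 1 : ℕ) + 1 = N := by omega
    exact_mod_cast this
  rw [h']
  split_ifs with hend
  · rcases hend with rfl | rfl
    · rw [Chebyshev.node_eq_one, Chebyshev.U_eval_one, Chebyshev.T_eval_one, hc, abs_neg,
        abs_of_nonneg (by positivity)]
      ring
    · rw [Chebyshev.node_eq_neg_one (by omega), Chebyshev.U_eval_neg_one, Chebyshev.T_eval_neg_one,
        hc]
      have hs : (α : ℤ).negOnePow = -((α - 1 : ℕ) : ℤ).negOnePow := by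
        rw [← Int.negOnePow_succ]
        congr 1; omega
      rw [hs]
      push_cast
      rw [show -(-1 * ((((((α - 1 : ℕ) : ℤ).negOnePow : ℤˣ) : ℤ) : ℝ) * α)
        + α * -((((α - 1 : ℕ) : ℤ).negOnePow : ℤˣ) : ℤ))
        = ((((α - 1 : ℕ) : ℤ).negOnePow : ℤˣ) : ℤ) * (2 * α) by ring, abs_mul]
      rcases Int.units_eq_one_or (((α - 1 : ℕ) : ℤ).negOnePow) with hu | hu <;> rw [hu] <;> simp
  · have hs : Real.sin (α * (Real.pi / N)) ≠ 0 := by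
      apply ne_of_gt
      have h1 : (0 : ℝ) < α := by exact_mod_cast (by omega : 0 < α)
      have h2 : (α : ℝ) < N := by exact_mod_cast (by omega : α < N)
      have h3 : (0 : ℝ) < N := h1.trans h2
      apply Real.sin_pos_of_pos_of_lt_pi (mul_pos h1 (div_pos Real.pi_pos h3))
      rw [mul_div_assoc', div_lt_iff₀ h3]
      nlinarith [Real.pi_pos]
    have hU : (Chebyshev.U ℝ (N - 1 : ℕ)).eval (Chebyshev.node N α) = 0 := by
      have h := Chebyshev.U_real_cos (α * (Real.pi / N)) ((N - 1 : ℕ) : ℤ)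
      rw [hc, show (N : ℝ) * (α * (Real.pi / N)) = α * Real.pi by field_simp,
        Real.sin_nat_mul_pi] at h
      rw [node_eq_cos]
      exact (mul_eq_zero.1 h).resolve_right hs
    rw [hU, Chebyshev.eval_T_real_node (by simpa using hα)]
    simp [abs_mul]

lemma abs_sin_div_cos_sub_cos_le {θ φ : ℝ} (h : Real.cos θ ≠ Real.cos φ) :
    |Real.sin θ| / |Real.cos θ - Real.cos φ|
      ≤ (|Real.cot ((θ - φ) / 2)| + |Real.cot ((θ + φ) / 2)|) / 2 := by
  have hd := Real.cos_sub_cos θ φ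
  have hne := sub_ne_zero.2 h
  rw [hd] at hne
  have ha : Real.sin ((θ - φ) / 2) ≠ 0 := fun h0 => hne (by rw [h0]; ring)
  have hb : Real.sin ((θ + φ) / 2) ≠ 0 := fun h0 => hne (by rw [h0]; ring)
  have key : Real.sin θ / (Real.cos θ - Real.cos φ)
      = -(Real.cot ((θ - φ) / 2) + Real.cot ((θ + φ) / 2)) / 2 := by
    rw [hd, Real.cot_eq_cos_div_sin, Real.cot_eq_cos_div_sin]
    conv_lhs => rw [show θ = (θ - φ) / 2 + (θ + φ) / 2 by ring, Real.sin_add]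
    rw [← show θ = (θ - φ) / 2 + (θ + φ) / 2 by ring]
    field_simp
    ring
  rw [← abs_div, key, abs_div, abs_neg, abs_of_pos (two_pos : (0 : ℝ) < 2)]
  gcongr
  exact abs_add_le _ _

lemma sum_shift_of_periodic {N : ℕ} {g : ℤ → ℝ} (hg : ∀ j, g (j + 2 * N) = g j) (p : ℕ) :
    ∑ i ∈ range N, g (p + i) + ∑ i ∈ range N, g (p - (i + 1))
      = ∑ i ∈ range N, g i + ∑ i ∈ range N, g (-(i + 1)) := by
  induction p with
  | zero => simp
  | succ p ih =>
    rw [← ih]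
    have h1 := (sum_range_succ (fun i : ℕ => g (p + i)) N).symm.trans
      (sum_range_succ' (fun i : ℕ => g (p + i)) N)
    have h2 := (sum_range_succ (fun i : ℕ => g (p - i)) N).symm.trans
      (sum_range_succ' (fun i : ℕ => g (p - i)) N)
    have h3 := hg (p - N)
    rw [show (p : ℤ) - N + 2 * N = p + N by ring] at h3
    push_cast at h1 h2 ⊢
    have e1 : ∀ i : ℕ, g ((p : ℤ) + 1 + i) = g (p + (i + 1)) := fun i => by congr 1; ring
    have e2 : ∀ i : ℕ, g ((p : ℤ) + 1 - (i + 1)) = g (p - i) := fun i => by congr 1; ring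
    simp only [e1, e2, add_zero, sub_zero] at h1 h2 ⊢
    linarith

lemma sum_half_ends_of_periodic {N : ℕ} (hN : 1 ≤ N) {g : ℤ → ℝ} (hg : ∀ j, g (j + 2 * N) = g j) :
    ∑ α ∈ range (N + 1), (if α = 0 ∨ α = N then 1 / 2 else 1) * (g α + g (-α))
      = ∑ i ∈ range N, g i + ∑ i ∈ range N, g (-(i + 1)) := by
  obtain ⟨M, rfl⟩ : ∃ M, N = M + 1 := ⟨N - 1, by omega⟩
  rw [sum_range_succ, sum_range_succ', sum_range_succ' (fun i : ℕ => g i),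
    sum_range_succ (fun i : ℕ => g (-(i + 1)))]
  have hmid : ∑ k ∈ range M, (if k + 1 = 0 ∨ k + 1 = M + 1 then (1 / 2 : ℝ) else 1) *
      (g ((k + 1 : ℕ) : ℤ) + g (-((k + 1 : ℕ) : ℤ)))
      = ∑ k ∈ range M, g ((k + 1 : ℕ) : ℤ) + ∑ k ∈ range M, g (-((k : ℤ) + 1)) := by
    rw [← sum_add_distrib]
    refine sum_congr rfl fun k hk => ?_
    have := mem_range.1 hk
    rw [if_neg (by omega), one_mul]
    push_cast
    rfl
  rw [hmid]
  have h3 := hg (-((M : ℤ) + 1))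
  rw [show -((M : ℤ) + 1) + 2 * ((M + 1 : ℕ) : ℤ) = M + 1 by push_cast; ring] at h3
  simp only [true_or, or_true, if_true]
  push_cast
  rw [h3]
  simp only [neg_zero]
  ring

lemma abs_cot_sub_pi (x : ℝ) : |Real.cot (x - Real.pi)| = |Real.cot x| := by
  rw [Real.cot_eq_cos_div_sin, Real.cot_eq_cos_div_sin, Real.cos_sub_pi, Real.sin_sub_pi,
    neg_div_neg_eq]

lemma cot_nonneg_of_le {x : ℝ} (h0 : 0 ≤ x) (h1 : x ≤ Real.pi / 2) : 0 ≤ Real.cot x := by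
  rw [Real.cot_eq_cos_div_sin]
  exact div_nonneg (Real.cos_nonneg_of_mem_Icc ⟨by linarith [Real.pi_pos], h1⟩)
    (Real.sin_nonneg_of_nonneg_of_le_pi h0 (by linarith [Real.pi_pos]))

lemma sin_mul_cot_add_cot_le {N i : ℕ} (hi : i < N) {u : ℝ} (hu0 : 0 < u) (hu1 : u < 1) :
    Real.sin (Real.pi * u) * (Real.cot ((i + u) * (Real.pi / (2 * N)))
      + Real.cot ((i + 1 - u) * (Real.pi / (2 * N))))
      ≤ 2 * Real.cot ((2 * i + 1) * (Real.pi / (4 * N))) := by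
  have hpi := Real.pi_pos
  have hi0 : (0 : ℝ) ≤ i := i.cast_nonneg
  have hiN : (i : ℝ) + 1 ≤ N := by exact_mod_cast hi
  have hN0 : (0 : ℝ) < N := by linarith
  have hs : Real.pi / (4 * N) ≤ (2 * i + 1) * (Real.pi / (4 * N)) :=
    le_mul_of_one_le_left (by positivity) (by linarith)
  have hs' : (2 * i + 1) * (Real.pi / (4 * N)) < Real.pi / 2 := by
    rw [mul_div_assoc', div_lt_div_iff₀ (by positivity) (by norm_num)]
    nlinarith
  have hN1 : 1 ≤ N := by omega
  rcases le_total (1 / 2) u with h | h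
  · have := cos_mul_cot_add_cot_le hN1 hs hs' (δ := (2 * u - 1) * (Real.pi / (4 * N)))
      (mul_nonneg (by linarith) (by positivity))
      (mul_lt_of_lt_one_left (by positivity) (by linarith))
    rw [show (N : ℝ) * (2 * ((2 * u - 1) * (Real.pi / (4 * N)))) = Real.pi * u - Real.pi / 2 by
      field_simp; ring, Real.cos_sub_pi_div_two] at this
    refine le_trans (le_of_eq ?_) this
    rw [add_comm]
    congr 3 <;> (field_simp; ring)
  · have := cos_mul_cot_add_cot_le hN1 hs hs' (δ := (1 - 2 * u) * (Real.pi / (4 * N)))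
      (mul_nonneg (by linarith) (by positivity))
      (mul_lt_of_lt_one_left (by positivity) (by linarith))
    rw [show (N : ℝ) * (2 * ((1 - 2 * u) * (Real.pi / (4 * N)))) = Real.pi / 2 - Real.pi * u by
      field_simp; ring, Real.cos_pi_div_two_sub] at this
    refine le_trans (le_of_eq ?_) this
    congr 3 <;> (field_simp; ring)

lemma abs_eval_basis_cos_le {N : ℕ} (hN : 1 ≤ N) {α : ℕ} (hα : α ≤ N) {θ : ℝ}
    (hθ : Real.cos θ ≠ Chebyshev.node N α) :
    |(Lagrange.basis (range (N + 1)) (Chebyshev.node N) α).eval (Real.cos θ)|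
      ≤ |Real.sin (N * θ)| / (2 * N) * ((if α = 0 ∨ α = N then 1 / 2 else 1) *
        (|Real.cot ((θ - α * (Real.pi / N)) / 2)| + |Real.cot ((θ + α * (Real.pi / N)) / 2)|)) := by
  have hN0 : (0 : ℝ) < N := by exact_mod_cast hN
  rw [eval_basis_eq hN (mem_range.2 (by omega)) hθ, eval_lobattoPoly_cos hN, abs_div, abs_mul,
    abs_mul, abs_eval_derivative_lobattoPoly hN hα]
  rw [node_eq_cos] at hθ ⊢
  have h := abs_sin_div_cos_sub_cos_le hθ
  have h' := mul_le_mul_of_nonneg_left h (abs_nonneg (Real.sin (N * θ)))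
  split_ifs
  · refine le_trans (le_of_eq ?_) ((mul_le_mul_of_nonneg_left h'
      (by positivity : 0 ≤ 1 / (2 * (N : ℝ)))).trans_eq ?_)
    · rw [mul_comm (|Real.sin θ|), div_mul_eq_div_mul_one_div, mul_div_assoc]; ring
    · ring
  · refine le_trans (le_of_eq ?_) ((mul_le_mul_of_nonneg_left h'
      (by positivity : 0 ≤ 1 / (N : ℝ))).trans_eq ?_)
    · rw [mul_comm (|Real.sin θ|), div_mul_eq_div_mul_one_div, mul_div_assoc]; ring
    · field_simp

/-- The Lebesgue constant of the Chebyshev-Lobatto nodes on `[-1, 1]`. -/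
theorem sum_abs_eval_basis_le {N : ℕ} (hN : 1 ≤ N) {x : ℝ} (hx : x ∈ Set.Icc (-1 : ℝ) 1) :
    ∑ α ∈ range (N + 1), |(Lagrange.basis (range (N + 1)) (Chebyshev.node N) α).eval x|
      ≤ 1 + (2 / Real.pi) * Real.log (N + 1) := by
  have hpi := Real.pi_pos
  have hN0 : (0 : ℝ) < N := by exact_mod_cast hN
  by_cases hnode : ∃ α ∈ range (N + 1), x = Chebyshev.node N α
  · obtain ⟨α, hα, rfl⟩ := hnode
    rw [sum_eq_single_of_mem α hα]
    · rw [Lagrange.eval_basis_self (chebyshevNode_injOn N) hα, abs_one]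
      have : 0 ≤ Real.log ((N : ℝ) + 1) := Real.log_nonneg (by linarith)
      have : 0 ≤ (2 / Real.pi) * Real.log ((N : ℝ) + 1) := by positivity
      linarith
    · intro β _ hβα
      rw [Lagrange.eval_basis_of_ne hβα hα, abs_zero]
  · push Not at hnode
    set θ := Real.arccos x with hθdef
    have hcos : Real.cos θ = x := Real.cos_arccos hx.1 hx.2
    have hθ0 : 0 ≤ θ := Real.arccos_nonneg x
    have hθpi : θ ≤ Real.pi := Real.arccos_le_pi x
    set p := ⌊N * θ / Real.pi⌋₊ with hp
    set u := N * θ / Real.pi - p with hu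
    have hp_le : (p : ℝ) ≤ N * θ / Real.pi := Nat.floor_le (by positivity)
    have hu1 : u < 1 := by
      have := Nat.lt_floor_add_one (N * θ / Real.pi)
      rw [hu]; linarith
    have hθu : θ = (p + u) * (Real.pi / N) := by
      rw [hu]; field_simp; ring
    have hu0 : 0 < u := by
      rcases (sub_nonneg.2 hp_le).lt_or_eq with h | h
      · exact h
      · exfalso
        rw [← hu] at h
        rw [← h, add_zero] at hθu
        have hpN : p ≤ N := by
          have : (p : ℝ) ≤ N := by
            refine hp_le.trans ?_
            rw [div_le_iff₀ hpi]
            exact mul_le_mul_of_nonneg_left hθpi hN0.le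
          exact_mod_cast this
        refine hnode p (mem_range.2 (by omega)) ?_
        rw [node_eq_cos, ← hθu, hcos]
    set g : ℤ → ℝ := fun j => |Real.cot ((θ - j * (Real.pi / N)) / 2)| with hg
    have hper : ∀ j, g (j + 2 * N) = g j := by
      intro j
      simp only [hg]
      rw [← abs_cot_sub_pi ((θ - j * (Real.pi / N)) / 2)]
      congr 2
      push_cast
      field_simp
      ring
    have hsin : |Real.sin (N * θ)| = Real.sin (Real.pi * u) := by
      have : (N : ℝ) * θ = Real.pi * u + p * Real.pi := by
        rw [hθu]; field_simp; ring
      rw [this, Real.sin_add_nat_mul_pi, abs_mul, abs_pow, abs_neg, abs_one, one_pow, one_mul,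
        abs_of_nonneg]
      apply Real.sin_nonneg_of_nonneg_of_le_pi (by positivity)
      nlinarith
    have h1 : ∑ α ∈ range (N + 1),
          |(Lagrange.basis (range (N + 1)) (Chebyshev.node N) α).eval x|
        ≤ Real.sin (Real.pi * u) / (2 * N) * ∑ α ∈ range (N + 1),
          (if α = 0 ∨ α = N then 1 / 2 else 1) * (g α + g (-α)) := by
      rw [mul_sum]
      refine sum_le_sum fun α hα => ?_
      have h := abs_eval_basis_cos_le hN (by have := mem_range.1 hα; omega : α ≤ N) (θ := θ)
        (by rw [hcos]; exact hnode α hα)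
      rw [hcos, hsin] at h
      simpa [hg] using h
    have hg1 : ∀ i ∈ range N, g (((p + 1 : ℕ) : ℤ) + i)
        = Real.cot ((i + 1 - u) * (Real.pi / (2 * N))) := by
      intro i hi
      have hi' : (i : ℝ) + 1 ≤ N := by exact_mod_cast mem_range.1 hi
      have hi0 : (0 : ℝ) ≤ i := i.cast_nonneg
      have e : (θ - ((((p + 1 : ℕ) : ℤ) + (i : ℤ) : ℤ) : ℝ) * (Real.pi / N)) / 2
          = -((i + 1 - u) * (Real.pi / (2 * N))) := by
        rw [hθu]; push_cast; field_simp; ring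
      simp only [hg]
      rw [e, Real.cot_eq_cos_div_sin, Real.cos_neg, Real.sin_neg, div_neg, abs_neg,
        ← Real.cot_eq_cos_div_sin, abs_of_nonneg]
      apply cot_nonneg_of_le (mul_nonneg (by linarith) (by positivity))
      rw [mul_div_assoc', div_le_div_iff₀ (by positivity) (by norm_num)]
      nlinarith
    have hg2 : ∀ i ∈ range N, g (((p + 1 : ℕ) : ℤ) - (i + 1))
        = Real.cot ((i + u) * (Real.pi / (2 * N))) := by
      intro i hi
      have hi' : (i : ℝ) + 1 ≤ N := by exact_mod_cast mem_range.1 hi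
      have hi0 : (0 : ℝ) ≤ i := i.cast_nonneg
      have e : (θ - ((((p + 1 : ℕ) : ℤ) - ((i : ℤ) + 1) : ℤ) : ℝ) * (Real.pi / N)) / 2
          = (i + u) * (Real.pi / (2 * N)) := by
        rw [hθu]; push_cast; field_simp; ring
      simp only [hg]
      rw [e, abs_of_nonneg]
      apply cot_nonneg_of_le (mul_nonneg (by linarith) (by positivity))
      rw [mul_div_assoc', div_le_div_iff₀ (by positivity) (by norm_num)]
      nlinarith
    rw [sum_half_ends_of_periodic hN hper, ← sum_shift_of_periodic hper (p + 1),
      sum_congr rfl hg1, sum_congr rfl hg2, add_comm (Finset.sum _ _) (Finset.sum _ _),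
      ← sum_add_distrib, div_mul_eq_mul_div, mul_sum] at h1
    refine h1.trans (le_trans ?_ (sum_cot_le hN))
    have h2 := sum_le_sum fun i (hi : i ∈ range N) =>
      sin_mul_cot_add_cot_le (mem_range.1 hi) hu0 hu1
    rw [div_le_iff₀ (by positivity)]
    refine h2.trans_eq ?_
    rw [← mul_sum]
    generalize ∑ i ∈ range N, Real.cot _ = S
    field_simp

/-- The Lebesgue constant of the Chebyshev-Lobatto grid on `[0, 1]`. -/
theorem sum_abs_chebP_le {N : ℕ} (hN : 1 ≤ N) {x : ℝ} (hx : x ∈ Set.Icc (0 : ℝ) 1) :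
    ∑ α ∈ range (N + 1), |chebP N α x| ≤ 1 + (2 / Real.pi) * Real.log (N + 1) := by
  simp only [chebP_eq_eval_basis]
  exact sum_abs_eval_basis_le hN ⟨by linarith [hx.1], by linarith [hx.2]⟩

lemma chebNode_mem_Icc (N α : ℕ) : chebNode N α ∈ Set.Icc (0 : ℝ) 1 := by
  rw [chebNode]
  constructor <;>
    linarith [Real.neg_one_le_cos (Real.pi * α / N), Real.cos_le_one (Real.pi * α / N)]

lemma two_mul_chebNode_sub_one (N α : ℕ) : 2 * chebNode N α - 1 = Chebyshev.node N α := by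
  rw [chebNode_eq]; ring

/-- The error at `x` of Chebyshev-Lobatto interpolation of `g` on `[0, 1]`. -/
def chebInterpError {E : Type*} [AddCommGroup E] [Module ℝ E] (N : ℕ) (x : ℝ) (g : ℝ → E) : E :=
  g x - ∑ α ∈ range (N + 1), chebP N α x • g (chebNode N α)

lemma chebInterpError_eval_eq_zero {N : ℕ} {P : ℝ[X]} (hP : P.degree ≤ N) (x : ℝ) :
    chebInterpError N x (fun y => P.eval (2 * y - 1)) = 0 := by
  have h := Lagrange.eq_interpolate (chebyshevNode_injOn N) (f := P)
    (by rw [card_range]; exact hP.trans_lt (by exact_mod_cast Nat.lt_succ_self N))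
  have h' := congrArg (eval (2 * x - 1)) h
  rw [chebInterpError, h', Lagrange.interpolate_apply, eval_finsetSum, sub_eq_zero]
  refine sum_congr rfl fun α _ => ?_
  rw [eval_mul, eval_C, chebP_eq_eval_basis, two_mul_chebNode_sub_one, smul_eq_mul, mul_comm]

lemma exists_eval_T_node_eq {N : ℕ} (hN : 1 ≤ N) (n : ℤ) :
    ∃ m : ℕ, m ≤ N ∧ ∀ α : ℕ, (Chebyshev.T ℝ n).eval (Chebyshev.node N α)
      = (Chebyshev.T ℝ m).eval (Chebyshev.node N α) := by
  have hN0 : (N : ℝ) ≠ 0 := by exact_mod_cast (by omega : N ≠ 0)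
  have hdiv := Int.emod_add_mul_ediv n (2 * N)
  have h0 := Int.emod_nonneg n (by omega : (2 * N : ℤ) ≠ 0)
  have h1 := Int.emod_lt_of_pos n (by omega : (0 : ℤ) < 2 * N)
  set r := n % (2 * N)
  set q := n / (2 * N)
  rcases le_or_gt r N with hr | hr
  · refine ⟨r.toNat, by omega, fun α => ?_⟩
    rw [node_eq_cos, Chebyshev.T_real_cos, Chebyshev.T_real_cos, Int.toNat_of_nonneg h0,
      ← Real.cos_add_int_mul_two_pi (r * (α * (Real.pi / N))) (q * α)]
    congr 1
    rw [← hdiv]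
    push_cast
    field_simp
  · refine ⟨(2 * N - r).toNat, by omega, fun α => ?_⟩
    rw [node_eq_cos, Chebyshev.T_real_cos, Chebyshev.T_real_cos,
      Int.toNat_of_nonneg (by omega), ← Real.cos_neg (((2 * N - r : ℤ) : ℝ) * _),
      ← Real.cos_add_int_mul_two_pi (-(((2 * N - r : ℤ) : ℝ) * _)) ((q + 1) * α)]
    congr 1
    rw [← hdiv]
    push_cast
    field_simp
    ring

lemma abs_chebInterpError_T_le {N : ℕ} (hN : 1 ≤ N) (n : ℤ) {x : ℝ} (hx : x ∈ Set.Icc (0 : ℝ) 1) :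
    |chebInterpError N x (fun y => (Chebyshev.T ℝ n).eval (2 * y - 1))| ≤ 2 := by
  obtain ⟨m, hm, h⟩ := exists_eval_T_node_eq hN n
  have h0 := chebInterpError_eval_eq_zero (N := N) (P := Chebyshev.T ℝ m)
    (by rw [Chebyshev.degree_T]; exact_mod_cast hm) x
  have hx' : |2 * x - 1| ≤ 1 := abs_le.2 ⟨by linarith [hx.1], by linarith [hx.2]⟩
  have h1 := Chebyshev.abs_eval_T_real_le_one n hx'
  have h2 := Chebyshev.abs_eval_T_real_le_one m hx'
  simp only [chebInterpError, two_mul_chebNode_sub_one, h] at h0 ⊢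
  rw [sub_eq_zero] at h0
  rw [← h0]
  exact (abs_sub _ _).trans (by linarith)

lemma abs_chebInterpError_pow_mul_T_le {N : ℕ} (hN : 1 ≤ N) (p : ℕ) {x : ℝ}
    (hx : x ∈ Set.Icc (0 : ℝ) 1) (n : ℤ) :
    |chebInterpError N x (fun y => (2 * y - 1) ^ p * (Chebyshev.T ℝ n).eval (2 * y - 1))|
      ≤ 2 * (1 / 2) ^ N * (5 / 4) ^ p * (2 ^ n + 2 ^ (-n)) := by
  induction p generalizing n with
  | zero =>
    simp only [pow_zero, one_mul, mul_one]
    rcases le_or_gt n.natAbs N with hn | hn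
    · rw [chebInterpError_eval_eq_zero (by rw [Chebyshev.degree_T]; exact_mod_cast hn), abs_zero]
      positivity
    · refine (abs_chebInterpError_T_le hN n hx).trans ?_
      have hpow : (2 : ℝ) ^ (N : ℤ) ≤ 2 ^ n + 2 ^ (-n) := by
        rcases le_total 0 n with h | h
        · have h1 : (2 : ℝ) ^ (N : ℤ) ≤ 2 ^ n := zpow_le_zpow_right₀ (by norm_num) (by omega)
          have h2 : (0 : ℝ) < 2 ^ (-n) := by positivity
          linarith
        · have h1 : (2 : ℝ) ^ (N : ℤ) ≤ 2 ^ (-n) := zpow_le_zpow_right₀ (by norm_num) (by omega)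
          have h2 : (0 : ℝ) < 2 ^ n := by positivity
          linarith
      rw [zpow_natCast] at hpow
      calc (2 : ℝ) = 2 * (1 / 2) ^ N * 2 ^ N := by rw [mul_assoc, ← mul_pow]; norm_num
        _ ≤ _ := by gcongr
  | succ p ih =>
    have hsplit : chebInterpError N x
          (fun y => (2 * y - 1) ^ (p + 1) * (Chebyshev.T ℝ n).eval (2 * y - 1))
        = (chebInterpError N x
            (fun y => (2 * y - 1) ^ p * (Chebyshev.T ℝ (n + 1)).eval (2 * y - 1))
          + chebInterpError N x
            (fun y => (2 * y - 1) ^ p * (Chebyshev.T ℝ (n - 1)).eval (2 * y - 1))) / 2 := by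
      have hT : ∀ y : ℝ, (2 * y - 1) ^ (p + 1) * (Chebyshev.T ℝ n).eval (2 * y - 1)
          = ((2 * y - 1) ^ p * (Chebyshev.T ℝ (n + 1)).eval (2 * y - 1)
            + (2 * y - 1) ^ p * (Chebyshev.T ℝ (n - 1)).eval (2 * y - 1)) / 2 := by
        intro y
        rw [Chebyshev.T_add_one]
        simp only [eval_sub, eval_mul, eval_X, eval_ofNat]
        ring
      simp only [chebInterpError, hT, smul_eq_mul, mul_div_assoc', mul_add, ← sum_div,
        sum_add_distrib]
      ring
    rw [hsplit, abs_div, abs_two, div_le_iff₀ two_pos]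
    refine (abs_add_le _ _).trans ((add_le_add (ih (n + 1)) (ih (n - 1))).trans_eq ?_)
    have h2 : (2 : ℝ) ≠ 0 := two_ne_zero
    rw [neg_add, neg_sub', sub_neg_eq_add, zpow_add₀ h2, zpow_add₀ h2, zpow_add₀ h2, zpow_sub₀ h2]
    norm_num
    ring

lemma norm_chebInterpError_exp_le {N : ℕ} (hN : 1 ≤ N) (ν : ℝ) {x : ℝ}
    (hx : x ∈ Set.Icc (0 : ℝ) 1) :
    ‖chebInterpError N x (fun y => Complex.exp (Complex.I * ν * ((2 * y - 1 : ℝ) : ℂ)))‖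
      ≤ 4 * (1 / 2) ^ N * Real.exp (5 / 4 * |ν|) := by
  have hexp : ∀ y : ℝ, HasSum (fun p : ℕ => (Complex.I * ν) ^ p / (p.factorial : ℂ)
      * (((2 * y - 1) ^ p : ℝ) : ℂ)) (Complex.exp (Complex.I * ν * ((2 * y - 1 : ℝ) : ℂ))) := by
    intro y
    have h := NormedSpace.expSeries_div_hasSum_exp (Complex.I * ν * ((2 * y - 1 : ℝ) : ℂ))
    rw [← Complex.exp_eq_exp_ℂ] at h
    refine h.congr_fun fun p => ?_
    rw [mul_pow, Complex.ofReal_pow]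
    ring
  have herr : HasSum (fun p : ℕ => (Complex.I * ν) ^ p / (p.factorial : ℂ)
      * ((chebInterpError N x (fun y => (2 * y - 1) ^ p) : ℝ) : ℂ))
      (chebInterpError N x (fun y => Complex.exp (Complex.I * ν * ((2 * y - 1 : ℝ) : ℂ)))) := by
    refine ((hexp x).sub (hasSum_sum fun α _ =>
      (hexp (chebNode N α)).const_smul (chebP N α x))).congr_fun fun p => ?_
    simp only [chebInterpError, Complex.ofReal_sub, Complex.ofReal_sum, mul_sub, mul_sum,
      smul_eq_mul, Complex.ofReal_mul, Complex.real_smul]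
    congr 1
    refine sum_congr rfl fun α _ => ?_
    ring
  have hbound : HasSum (fun p : ℕ => 4 * (1 / 2 : ℝ) ^ N * ((5 / 4 * |ν|) ^ p / p.factorial))
      (4 * (1 / 2) ^ N * Real.exp (5 / 4 * |ν|)) := by
    have h := NormedSpace.expSeries_div_hasSum_exp (5 / 4 * |ν|)
    rw [← Real.exp_eq_exp_ℝ] at h
    exact h.mul_left _
  rw [← herr.tsum_eq]
  refine tsum_of_norm_bounded hbound fun p => ?_
  have h := abs_chebInterpError_pow_mul_T_le hN p hx 0
  simp only [Chebyshev.T_zero, eval_one, mul_one, neg_zero, zpow_zero] at h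
  rw [norm_mul, norm_div, norm_pow, norm_mul, Complex.norm_I, one_mul, Complex.norm_real,
    Complex.norm_natCast, Complex.norm_real, Real.norm_eq_abs, Real.norm_eq_abs]
  calc _ ≤ |ν| ^ p / p.factorial * (2 * (1 / 2) ^ N * (5 / 4) ^ p * (1 + 1)) := by gcongr
    _ = _ := by rw [mul_pow]; ring

lemma norm_chebInterpError_exp_affine_le {N : ℕ} {Ω Δ b : ℝ} (hb : 0 ≤ b) (hΩ : 0 ≤ Ω)
    (hΔ : 0 < Δ) (hN : b * Ω + Δ ≤ N) (a : ℝ) {ω : ℝ} (hω : |ω| ≤ Ω) {x : ℝ}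
    (hx : x ∈ Set.Icc (0 : ℝ) 1) :
    ‖chebInterpError N x (fun y => Complex.exp (Complex.I * ω * ((a + b * y : ℝ) : ℂ)))‖
      ≤ 4 * Real.exp (-Δ / 2) := by
  have hbΩ : 0 ≤ b * Ω := mul_nonneg hb hΩ
  have hN1 : 1 ≤ N := by
    have : (0 : ℝ) < N := by linarith
    exact_mod_cast this
  have hfac : ∀ y : ℝ, Complex.exp (Complex.I * ω * ((a + b * y : ℝ) : ℂ))
      = Complex.exp (((ω * (a + b / 2) : ℝ) : ℂ) * Complex.I)
        * Complex.exp (Complex.I * ((ω * b / 2 : ℝ) : ℂ) * ((2 * y - 1 : ℝ) : ℂ)) := by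
    intro y
    rw [← Complex.exp_add]
    congr 1
    push_cast
    ring
  have herr : chebInterpError N x (fun y => Complex.exp (Complex.I * ω * ((a + b * y : ℝ) : ℂ)))
      = Complex.exp (((ω * (a + b / 2) : ℝ) : ℂ) * Complex.I) * chebInterpError N x
        (fun y => Complex.exp (Complex.I * ((ω * b / 2 : ℝ) : ℂ) * ((2 * y - 1 : ℝ) : ℂ))) := by
    simp only [chebInterpError, hfac, mul_sub, mul_sum, mul_smul_comm]
  rw [herr, norm_mul, Complex.norm_exp_ofReal_mul_I, one_mul]
  refine (norm_chebInterpError_exp_le hN1 _ hx).trans ?_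
  have hν : |ω * b / 2| ≤ b * Ω / 2 := by
    rw [abs_div, abs_mul, abs_of_nonneg hb, abs_two]
    nlinarith
  have h2 : (1 / 2 : ℝ) ^ N = Real.exp (-(N * Real.log 2)) := by
    rw [Real.exp_neg, mul_comm, Real.exp_mul, Real.exp_log two_pos, Real.rpow_natCast, one_div,
      inv_pow]
  rw [h2, mul_assoc, ← Real.exp_add]
  gcongr
  nlinarith [Real.log_two_gt_d9]

open MeasureTheory

lemma totalVariation_eq (μ : SignedMeasure ℝ) :
    μ.totalVariation = μ.toJordanDecomposition.posPart + μ.toJordanDecomposition.negPart := rfl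

lemma tv_eq_add (μ : SignedMeasure ℝ) :
    tv μ = μ.toJordanDecomposition.posPart.real Set.univ
      + μ.toJordanDecomposition.negPart.real Set.univ := by
  rw [tv, totalVariation_eq, Measure.add_apply,
    ENNReal.toReal_add (measure_ne_top _ _) (measure_ne_top _ _)]
  rfl

lemma tv_nonneg (μ : SignedMeasure ℝ) : 0 ≤ tv μ := ENNReal.toReal_nonneg

lemma norm_sintegral_le {Ω C : ℝ} {μ : SignedMeasure ℝ}
    (hμ : μ.totalVariation (Set.Icc (-Ω) Ω)ᶜ = 0) {g : ℝ → ℂ} (hg : ∀ ω, |ω| ≤ Ω → ‖g ω‖ ≤ C) :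
    ‖sintegral μ g‖ ≤ C * tv μ := by
  rw [totalVariation_eq, Measure.add_apply, add_eq_zero] at hμ
  have hae : ∀ {m : Measure ℝ}, m (Set.Icc (-Ω) Ω)ᶜ = 0 → ∀ᵐ ω ∂m, ‖g ω‖ ≤ C := by
    intro m hm
    filter_upwards [mem_ae_iff.2 hm] with ω hω
    exact hg ω (abs_le.2 hω)
  rw [sintegral, tv_eq_add, mul_add]
  exact (norm_sub_le _ _).trans (add_le_add (norm_integral_le_of_norm_le_const (hae hμ.1))
    (norm_integral_le_of_norm_le_const (hae hμ.2)))

lemma integrable_exp_mul (m : Measure ℝ) [IsFiniteMeasure m] (x : ℝ) :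
    Integrable (fun ω : ℝ => Complex.exp (Complex.I * (ω : ℂ) * (x : ℂ))) m := by
  refine Integrable.of_bound (C := 1) (by fun_prop) (Filter.Eventually.of_forall fun ω => ?_)
  rw [show Complex.I * (ω : ℂ) * (x : ℂ) = ((ω * x : ℝ) : ℂ) * Complex.I by push_cast; ring,
    Complex.norm_exp_ofReal_mul_I]

lemma chebInterpError_integral_exp (m : Measure ℝ) [IsFiniteMeasure m] (N : ℕ) (x : ℝ)
    (l : ℝ → ℝ) :
    chebInterpError N x (fun y => ∫ ω, Complex.exp (Complex.I * (ω : ℂ) * (l y : ℂ)) ∂m)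
      = ∫ ω, chebInterpError N x (fun y => Complex.exp (Complex.I * (ω : ℂ) * (l y : ℂ))) ∂m := by
  simp only [chebInterpError]
  have hint : ∀ α : ℕ, Integrable (fun ω : ℝ => chebP N α x •
      Complex.exp (Complex.I * (ω : ℂ) * (l (chebNode N α) : ℂ))) m :=
    fun α => (integrable_exp_mul m (l (chebNode N α))).smul (chebP N α x)
  rw [integral_sub (integrable_exp_mul m _) (integrable_finsetSum _ fun α _ => hint α),
    integral_finsetSum _ fun α _ => hint α]
  simp only [integral_smul]

/-- Interpolation error of a bandlimited function on a dyadic subinterval. -/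
lemma abs_chebInterpError_bandlimited_le {Ω Δ : ℝ} {μ : SignedMeasure ℝ} {f : ℝ → ℝ}
    (hf : IsBandlimited Ω μ f) {N : ℕ} {b : ℝ} (hb : 0 ≤ b) (hΩ : 0 ≤ Ω) (hΔ : 0 < Δ)
    (hN : b * Ω + Δ ≤ N) (a : ℝ) {x : ℝ} (hx : x ∈ Set.Icc (0 : ℝ) 1) :
    |chebInterpError N x (fun y => f (a + b * y))|
      ≤ 2 / Real.pi * tv μ * Real.exp (-Δ / 2) := by
  have hcast : ((chebInterpError N x (fun y => f (a + b * y)) : ℝ) : ℂ)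
      = (1 / (2 * (Real.pi : ℂ))) * sintegral μ (fun ω => chebInterpError N x
        (fun y => Complex.exp (Complex.I * (ω : ℂ) * ((a + b * y : ℝ) : ℂ)))) := by
    rw [sintegral, ← chebInterpError_integral_exp, ← chebInterpError_integral_exp]
    simp only [chebInterpError, Complex.ofReal_sub, Complex.ofReal_sum, smul_eq_mul,
      Complex.ofReal_mul, hf.2, sintegral, mul_sub, mul_sum, sum_sub_distrib, Complex.real_smul,
      mul_left_comm]
    ring
  rw [← Real.norm_eq_abs, ← Complex.norm_real, hcast, norm_mul]
  have h := norm_sintegral_le hf.1 fun ω hω =>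
    norm_chebInterpError_exp_affine_le hb hΩ hΔ hN a hω hx
  have hc : ‖(1 / (2 * (Real.pi : ℂ)) : ℂ)‖ = 1 / (2 * Real.pi) := by
    rw [norm_div, norm_mul, Complex.norm_real, norm_one, Complex.norm_ofNat, Real.norm_eq_abs,
      abs_of_pos Real.pi_pos]
  rw [hc]
  refine (mul_le_mul_of_nonneg_left h (by positivity)).trans_eq ?_
  field_simp
  ring

lemma bitVal_nonneg (b : Bool) : 0 ≤ bitVal b := by
  cases b <;> simp [bitVal]

lemma bitVal_le_one (b : Bool) : bitVal b ≤ 1 := by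
  cases b <;> simp [bitVal]

/-- The dyadic number with binary digits `σ`. -/
def dyadicVal {K : ℕ} (σ : Fin K → Bool) : ℝ :=
  ∑ k : Fin K, (2 : ℝ) ^ (-(k.val + 1 : ℤ)) * bitVal (σ k)

lemma dyadicVal_succ {K : ℕ} (σ : Fin (K + 1) → Bool) :
    dyadicVal σ = dyadicVal (fun i => σ i.castSucc)
      + (2 : ℝ) ^ (-(K : ℤ)) * (bitVal (σ (Fin.last K)) / 2) := by
  rw [dyadicVal, dyadicVal, Fin.sum_univ_castSucc]
  simp only [Fin.val_castSucc, Fin.val_last]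
  rw [neg_add, zpow_add₀ two_ne_zero]
  norm_num
  ring

section Accumulation

variable {Ω Δ : ℝ} {μ : SignedMeasure ℝ} {f : ℝ → ℝ} {Nk : ℕ → ℕ}

/-- One interpolation step: the error of the partial products is amplified by the Lebesgue
constant and a new interpolation error is added. -/
lemma abs_sub_sum_Wcore_mul_chebP_le (hΩ : 0 < Ω) (hf : IsBandlimited Ω μ f) (hΔ : 0 < Δ)
    (hNk : ∀ k, Nk k = ⌈(2 : ℝ) ^ (-(k : ℤ)) * Ω + Δ⌉₊) {k : ℕ} {σ : Fin (k + 1) → Bool} {e : ℝ}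
    (he : ∀ β, |f (dyadicVal σ + (2 : ℝ) ^ (-((k + 1 : ℕ) : ℤ)) * chebNode (Nk (k + 1)) β)
      - Wcore f Nk k σ β| ≤ e) {y : ℝ} (hy : y ∈ Set.Icc (0 : ℝ) 1) :
    |f (dyadicVal σ + (2 : ℝ) ^ (-((k + 1 : ℕ) : ℤ)) * y)
      - ∑ γ ∈ range (Nk (k + 1) + 1), Wcore f Nk k σ γ * chebP (Nk (k + 1)) γ y|
      ≤ 2 / Real.pi * tv μ * Real.exp (-Δ / 2)
        + (1 + 2 / Real.pi * Real.log ((⌈Ω / 2 + Δ⌉₊ : ℝ) + 1)) * e := by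
  have hpi := Real.pi_pos
  have he0 : 0 ≤ e := (abs_nonneg _).trans (he 0)
  have hpow : (0 : ℝ) ≤ 2 ^ (-((k + 1 : ℕ) : ℤ)) := by positivity
  have hle : (2 : ℝ) ^ (-((k + 1 : ℕ) : ℤ)) * Ω + Δ ≤ Nk (k + 1) := by
    rw [hNk]; exact Nat.le_ceil _
  have hN1 : 1 ≤ Nk (k + 1) := by
    have : (0 : ℝ) < Nk (k + 1) := by nlinarith
    exact_mod_cast this
  have hNle : Nk (k + 1) ≤ ⌈Ω / 2 + Δ⌉₊ := by
    rw [hNk]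
    refine Nat.ceil_mono ?_
    have : (2 : ℝ) ^ (-((k + 1 : ℕ) : ℤ)) ≤ 2 ^ (-1 : ℤ) :=
      zpow_le_zpow_right₀ (by norm_num) (by push_cast; omega)
    have := mul_le_mul_of_nonneg_right this hΩ.le
    norm_num at this ⊢
    linarith
  have hΛ : ∑ γ ∈ range (Nk (k + 1) + 1), |chebP (Nk (k + 1)) γ y|
      ≤ 1 + 2 / Real.pi * Real.log ((⌈Ω / 2 + Δ⌉₊ : ℝ) + 1) := by
    refine (sum_abs_chebP_le hN1 hy).trans ?_
    gcongr
  have hmain := abs_chebInterpError_bandlimited_le hf hpow hΩ.le hΔ hle (dyadicVal σ) hy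
  have hsum : |∑ γ ∈ range (Nk (k + 1) + 1), chebP (Nk (k + 1)) γ y *
      (f (dyadicVal σ + (2 : ℝ) ^ (-((k + 1 : ℕ) : ℤ)) * chebNode (Nk (k + 1)) γ)
        - Wcore f Nk k σ γ)|
      ≤ (1 + 2 / Real.pi * Real.log ((⌈Ω / 2 + Δ⌉₊ : ℝ) + 1)) * e := by
    refine (abs_sum_le_sum_abs _ _).trans (le_trans ?_ (mul_le_mul_of_nonneg_right hΛ he0))
    rw [sum_mul]
    refine sum_le_sum fun γ _ => ?_
    rw [abs_mul]
    exact mul_le_mul_of_nonneg_left (he γ) (abs_nonneg _)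
  refine le_trans (le_of_eq ?_) ((abs_add_le _ _).trans (add_le_add hmain hsum))
  congr 1
  simp only [chebInterpError, smul_eq_mul, mul_sub, sum_sub_distrib]
  rw [sub_add_sub_cancel]
  congr 1
  exact sum_congr rfl fun γ _ => mul_comm _ _

lemma abs_sub_Wcore_le (hΩ : 0 < Ω) (hf : IsBandlimited Ω μ f) (hΔ : 0 < Δ)
    (hNk : ∀ k, Nk k = ⌈(2 : ℝ) ^ (-(k : ℤ)) * Ω + Δ⌉₊) (k : ℕ) (σ : Fin (k + 1) → Bool) (β : ℕ) :
    |f (dyadicVal σ + (2 : ℝ) ^ (-((k + 1 : ℕ) : ℤ)) * chebNode (Nk (k + 1)) β)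
      - Wcore f Nk k σ β|
      ≤ 2 / Real.pi * tv μ * Real.exp (-Δ / 2) *
        ∑ i ∈ range k, (1 + 2 / Real.pi * Real.log ((⌈Ω / 2 + Δ⌉₊ : ℝ) + 1)) ^ i := by
  induction k generalizing β with
  | zero =>
    have : dyadicVal σ + (2 : ℝ) ^ (-((0 + 1 : ℕ) : ℤ)) * chebNode (Nk (0 + 1)) β
        = (bitVal (σ 0) + chebNode (Nk 1) β) / 2 := by
      simp [dyadicVal]
      ring
    rw [this, Wcore]
    simp
  | succ k ih =>
    have hc := chebNode_mem_Icc (Nk (k + 2)) β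
    have h := abs_sub_sum_Wcore_mul_chebP_le hΩ hf hΔ hNk (ih fun i => σ i.castSucc)
      (y := (bitVal (σ (Fin.last (k + 1))) + chebNode (Nk (k + 2)) β) / 2)
      ⟨by linarith [bitVal_nonneg (σ (Fin.last (k + 1))), hc.1],
        by linarith [bitVal_le_one (σ (Fin.last (k + 1))), hc.2]⟩
    rw [Wcore, dyadicVal_succ]
    have harg : dyadicVal (fun i => σ i.castSucc)
          + (2 : ℝ) ^ (-((k + 1 : ℕ) : ℤ)) * (bitVal (σ (Fin.last (k + 1))) / 2)
          + (2 : ℝ) ^ (-((k + 1 + 1 : ℕ) : ℤ)) * chebNode (Nk (k + 1 + 1)) β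
        = dyadicVal (fun i => σ i.castSucc) + (2 : ℝ) ^ (-((k + 1 : ℕ) : ℤ))
          * ((bitVal (σ (Fin.last (k + 1))) + chebNode (Nk (k + 2)) β) / 2) := by
      have : (2 : ℝ) ^ (-((k + 1 + 1 : ℕ) : ℤ)) = 2 ^ (-((k + 1 : ℕ) : ℤ)) / 2 := by
        rw [show -((k + 1 + 1 : ℕ) : ℤ) = -((k + 1 : ℕ) : ℤ) - 1 by push_cast; ring,
          zpow_sub_one₀ two_ne_zero, div_eq_mul_inv]
      rw [this]
      ring
    rw [harg]
    refine h.trans_eq ?_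
    rw [geom_sum_succ]
    ring

end Accumulation
end

/-- a priori decaying-rank construction: for `f` the restriction of an
`Ω`-bandlimited function with spectral measure `μ`, `Δ > 0`, grid sizes
`N_k = ⌈2^{-k}Ω + Δ⌉`, and the MPS `S = A_L A_2 ⋯ A_{K-1} A_R`, one has
`max_σ |T(σ) - S(σ)| ≤ (2/π)|μ|(K-1)[1 + (2/π)log(⌈Ω/2+Δ⌉+1)]^{K-2} e^{-Δ/2}`. -/
theorem stmt13 (Ω : ℝ) (hΩ : 0 < Ω) (μ : MeasureTheory.SignedMeasure ℝ) (f : ℝ → ℝ)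
    (hf : IsBandlimited Ω μ f) (Δ : ℝ) (hΔ : 0 < Δ) (K : ℕ) (hK : 2 ≤ K)
    (Nk : ℕ → ℕ) (hNk : ∀ k, Nk k = ⌈(2 : ℝ) ^ (-(k : ℤ)) * Ω + Δ⌉₊) :
    ∀ σ : Fin K → Bool,
      |qtt f K σ -
        ∑ α ∈ Finset.range (Nk (K - 1) + 1),
          Wcore f Nk (K - 2) (fun i => σ ⟨i.val, by have := i.isLt; omega⟩) α *
            chebP (Nk (K - 1)) α (bitVal (σ ⟨K - 1, by omega⟩) / 2)|
      ≤ (2 / Real.pi) * tv μ * ((K : ℝ) - 1) *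
          (1 + (2 / Real.pi) * Real.log ((⌈Ω / 2 + Δ⌉₊ : ℝ) + 1)) ^ (K - 2) *
          Real.exp (-Δ / 2) := by
  intro σ
  obtain ⟨k, rfl⟩ : ∃ k, K = k + 2 := ⟨K - 2, by omega⟩
  set Λ := 1 + 2 / Real.pi * Real.log ((⌈Ω / 2 + Δ⌉₊ : ℝ) + 1) with hΛ
  have hΛ1 : 1 ≤ Λ := by
    have : 0 ≤ Real.log ((⌈Ω / 2 + Δ⌉₊ : ℝ) + 1) := Real.log_nonneg (by simp)
    have : 0 ≤ 2 / Real.pi * Real.log ((⌈Ω / 2 + Δ⌉₊ : ℝ) + 1) := by positivity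
    linarith
  have h := abs_sub_sum_Wcore_mul_chebP_le hΩ hf hΔ hNk
    (abs_sub_Wcore_le hΩ hf hΔ hNk k fun i => σ i.castSucc)
    (y := bitVal (σ (Fin.last (k + 1))) / 2)
    ⟨by linarith [bitVal_nonneg (σ (Fin.last (k + 1)))],
      by linarith [bitVal_le_one (σ (Fin.last (k + 1)))]⟩
  rw [← dyadicVal_succ, ← hΛ] at h
  refine h.trans ?_
  have hgeom : ∑ i ∈ Finset.range (k + 1), Λ ^ i ≤ (k + 1) * Λ ^ k := by
    have := Finset.sum_le_card_nsmul (Finset.range (k + 1)) (fun i => Λ ^ i) (Λ ^ k)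
      fun i hi => pow_le_pow_right₀ hΛ1 (Nat.lt_succ_iff.1 (Finset.mem_range.1 hi))
    simpa using this
  have hc : 0 ≤ 2 / Real.pi * tv μ * Real.exp (-Δ / 2) := by
    have := tv_nonneg μ
    positivity
  have hstep := mul_le_mul_of_nonneg_left hgeom hc
  rw [geom_sum_succ] at hstep
  refine le_trans (le_of_eq (by ring)) (hstep.trans_eq ?_)
  rw [Nat.add_sub_cancel]
  push_cast
  ring
end
end

section
/- For every integer N ≥ 1, the error of (N+1)-point Chebyshev-Lobatto interpolation of the square root function on the interval [1/2, 1] satisfies sup_{v ∈ [0,1]} |√(1/2 + v/2) − Σ_{α=0}^{N} √(1/2 + c_N^α/2) · P_N^α(v)| ≤ 2√6 · (3 + 2√2)^{−N} / (2 + 2√2), and in particular this error is at most 1.015 × (5.828)^{−N}. -/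
noncomputable section

/-- The binomial coefficients `Ring.choose (1/2) n` are bounded by `1` in absolute value. -/
theorem abs_choose_half_le_one (n : ℕ) : |Ring.choose (1 / 2 : ℝ) n| ≤ 1 := by
  induction n with
  | zero => simp
  | succ n ih =>
    have h := Ring.choose_smul_choose (1 / 2 : ℝ) (Nat.le_succ n)
    simp only [Nat.succ_eq_add_one, Nat.choose_succ_self_right, Nat.add_sub_cancel_left,
      Ring.choose_one_right, nsmul_eq_mul, Nat.cast_add, Nat.cast_one] at h
    have hn : (0 : ℝ) ≤ n := n.cast_nonneg
    have h2 : |(1 / 2 : ℝ) - n| ≤ n + 1 := abs_le.2 ⟨by linarith, by linarith⟩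
    have h3 := congrArg abs h
    rw [abs_mul, abs_mul, abs_of_pos (by linarith : (0 : ℝ) < n + 1)] at h3
    have h4 : |Ring.choose (1 / 2 : ℝ) n| * |(1 / 2 : ℝ) - n| ≤ 1 * (n + 1) := by gcongr
    by_contra! h5
    nlinarith

/-- The double Fourier series of `|H(z)|²` on the circle `z = r e^{iθ}`, for a power series `H`
with bounded real coefficients. -/
theorem hasSum_normSq_powerSeries {b : ℕ → ℝ} (hb : ∀ n, |b n| ≤ 1) {r : ℝ} (hr0 : 0 ≤ r)
    (hr1 : r < 1) (θ : ℝ) {H : ℂ}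
    (hH : HasSum (fun n : ℕ => (b n : ℂ) * (r * Complex.exp (θ * Complex.I)) ^ n) H) :
    HasSum (fun p : ℕ × ℕ => b p.1 * b p.2 * r ^ (p.1 + p.2) *
      Real.cos (((p.1 - p.2 : ℤ) : ℝ) * θ)) (‖H‖ ^ 2) := by
  generalize hz : (r : ℂ) * Complex.exp (θ * Complex.I) = z at hH
  have hzn : ‖z‖ = r := by
    rw [← hz, norm_mul, Complex.norm_exp_ofReal_mul_I, mul_one, Complex.norm_real,
      Real.norm_of_nonneg hr0]
  have hconj : HasSum (fun n : ℕ => (b n : ℂ) * (starRingEnd ℂ z) ^ n) (starRingEnd ℂ H) := by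
    have := Complex.hasSum_conj'.2 hH
    simpa using this
  have hgeo : Summable fun n : ℕ => r ^ n := summable_geometric_of_lt_one hr0 hr1
  have hle : ∀ n, ‖(b n : ℂ) * z ^ n‖ ≤ r ^ n := fun n => by
    rw [norm_mul, norm_pow, hzn, Complex.norm_real]
    exact mul_le_of_le_one_left (pow_nonneg hr0 n) (hb n)
  have hs1 : Summable fun n : ℕ => ‖(b n : ℂ) * z ^ n‖ :=
    Summable.of_nonneg_of_le (fun _ => norm_nonneg _) hle hgeo
  have hs2 : Summable fun n : ℕ => ‖(b n : ℂ) * (starRingEnd ℂ z) ^ n‖ := by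
    simpa using hs1
  have hs := summable_mul_of_summable_norm hs1 hs2
  have hmul := hH.mul hconj hs
  have hprod := Complex.hasSum_re hmul
  have hre : ∀ p : ℕ × ℕ, ((b p.1 : ℂ) * z ^ p.1 * (b p.2 * (starRingEnd ℂ z) ^ p.2)).re =
      b p.1 * b p.2 * r ^ (p.1 + p.2) * Real.cos (((p.1 - p.2 : ℤ) : ℝ) * θ) := by
    intro p
    have h1 : z ^ p.1 * (starRingEnd ℂ z) ^ p.2 =
        ((r ^ (p.1 + p.2) : ℝ) : ℂ) *
          Complex.exp (((((p.1 - p.2 : ℤ) : ℝ) * θ : ℝ) : ℂ) * Complex.I) := by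
      rw [← hz, map_mul, Complex.conj_ofReal, ← Complex.exp_conj, mul_pow, mul_pow,
        ← Complex.exp_nat_mul, ← Complex.exp_nat_mul, mul_mul_mul_comm, ← Complex.exp_add]
      simp only [map_mul, Complex.conj_ofReal, Complex.conj_I]
      push_cast
      rw [pow_add]
      congr 2
      ring
    have h2 : (b p.1 : ℂ) * z ^ p.1 * (b p.2 * (starRingEnd ℂ z) ^ p.2) =
        ((b p.1 * b p.2 : ℝ) : ℂ) * (z ^ p.1 * (starRingEnd ℂ z) ^ p.2) := by
      push_cast
      ring
    rw [h2, h1, Complex.re_ofReal_mul, Complex.re_ofReal_mul, Complex.exp_ofReal_mul_I_re]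
    ring
  simpa only [hre, Complex.mul_conj, Complex.ofReal_re, Complex.normSq_eq_norm_sq] using hprod

/-- The double Fourier series of `|1 + r e^{iθ}|`, obtained from the binomial series of
`(1 + r e^{iθ})^{1/2}`. -/
theorem hasSum_norm_one_add_exp {r : ℝ} (hr0 : 0 ≤ r) (hr1 : r < 1) (θ : ℝ) :
    HasSum (fun p : ℕ × ℕ => Ring.choose (1 / 2 : ℝ) p.1 * Ring.choose (1 / 2 : ℝ) p.2 *
        r ^ (p.1 + p.2) * Real.cos (((p.1 - p.2 : ℤ) : ℝ) * θ))
      ‖1 + r * Complex.exp (θ * Complex.I)‖ := by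
  have hmem : (r : ℂ) * Complex.exp (θ * Complex.I) ∈ Metric.eball (0 : ℂ) 1 := by
    rw [← ENNReal.ofReal_one, Metric.eball_ofReal, mem_ball_zero_iff, norm_mul,
      Complex.norm_exp_ofReal_mul_I, mul_one, Complex.norm_real, Real.norm_of_nonneg hr0]
    exact hr1
  have hH := (Complex.one_add_cpow_hasFPowerSeriesOnBall_zero
    (a := ((1 / 2 : ℝ) : ℂ))).hasSum hmem
  rw [zero_add] at hH
  simp only [binomialSeries_apply, List.ofFn_const, List.prod_replicate, ← Complex.ofReal_choose,
    smul_eq_mul] at hH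
  have h := hasSum_normSq_powerSeries abs_choose_half_le_one hr0 hr1 θ hH
  rwa [Complex.norm_cpow_real, ← Real.sqrt_eq_rpow, Real.sq_sqrt (norm_nonneg _)] at h

theorem chebNode_injOn {N : ℕ} (hN : 1 ≤ N) :
    Set.InjOn (chebNode N) (Finset.range (N + 1)) := by
  have hN' : (0 : ℝ) < N := by exact_mod_cast hN
  have hmem : ∀ a ∈ (Finset.range (N + 1) : Set ℕ),
      Real.pi * a / N ∈ Set.Icc 0 Real.pi := by
    intro a ha
    have ha' : (a : ℝ) ≤ N := by
      have : a ≤ N := by simpa [Nat.lt_succ_iff] using ha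
      exact_mod_cast this
    refine ⟨by positivity, ?_⟩
    rw [div_le_iff₀ hN']
    exact mul_le_mul_of_nonneg_left ha' Real.pi_pos.le
  intro a ha b hb hab
  have h : Real.cos (Real.pi * a / N) = Real.cos (Real.pi * b / N) := by
    unfold chebNode at hab
    linarith
  have h' := Real.injOn_cos (hmem a ha) (hmem b hb) h
  field_simp at h'
  exact_mod_cast h'

/-- Chebyshev–Lobatto interpolation reproduces `cos (d θ)` for `|d| ≤ N`. -/
theorem sum_cos_mul_chebP {N : ℕ} (hN : 1 ≤ N) {d : ℤ} (hd : d.natAbs ≤ N) (θ : ℝ) :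
    ∑ α ∈ Finset.range (N + 1), Real.cos (d * (Real.pi * α / N)) *
      chebP N α ((Real.cos θ + 1) / 2) = Real.cos (d * θ) := by
  set q : Polynomial ℝ := (Polynomial.Chebyshev.T ℝ d).comp
    (Polynomial.C 2 * Polynomial.X - Polynomial.C 1) with hq
  have hqe : ∀ t : ℝ, q.eval ((Real.cos t + 1) / 2) = Real.cos (d * t) := by
    intro t
    rw [hq, Polynomial.eval_comp, ← Polynomial.Chebyshev.T_real_cos]
    congr 1
    simp
    ring
  have hdeg : q.degree < (Finset.range (N + 1)).card := by
    refine lt_of_le_of_lt Polynomial.degree_le_natDegree ?_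
    rw [Finset.card_range]
    have h1 : q.natDegree ≤ N := by
      rw [hq]
      refine Polynomial.natDegree_comp_le.trans ?_
      rw [Polynomial.Chebyshev.natDegree_T]
      have : (Polynomial.C (2 : ℝ) * Polynomial.X - Polynomial.C 1).natDegree ≤ 1 := by
        compute_degree
      nlinarith
    exact_mod_cast Nat.lt_succ_of_le h1
  have h := congrArg (Polynomial.eval ((Real.cos θ + 1) / 2))
    (Lagrange.eq_interpolate (chebNode_injOn hN) hdeg)
  rw [hqe, Lagrange.interpolate_apply, Polynomial.eval_finsetSum] at h
  rw [h]
  refine Finset.sum_congr rfl fun α _ => ?_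
  rw [Polynomial.eval_mul, Polynomial.eval_C]
  congr 1
  · exact (hqe _).symm
  · rw [chebP, Lagrange.basis, Polynomial.eval_prod]
    refine Finset.prod_congr rfl fun β _ => ?_
    simp [Lagrange.basisDivisor, div_eq_inv_mul]

/-- Aliasing: on the Chebyshev–Lobatto grid every `cos (d θ)` coincides with one of
frequency at most `N`. -/
theorem exists_cos_alias {N : ℕ} (hN : 1 ≤ N) (d : ℤ) :
    ∃ m : ℤ, m.natAbs ≤ N ∧ ∀ α : ℕ,
      Real.cos (d * (Real.pi * α / N)) = Real.cos (m * (Real.pi * α / N)) := by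
  have hN' : (N : ℝ) ≠ 0 := by positivity
  refine ⟨d.bmod (2 * N), ?_, fun α => ?_⟩
  · have h1 := Int.le_bmod (x := d) (m := 2 * N) (by omega)
    have h2 := Int.bmod_lt (x := d) (m := 2 * N) (by omega)
    omega
  · obtain ⟨k, hk⟩ : ∃ k : ℤ, d = d.bmod (2 * N) + 2 * N * k :=
      ⟨d.bdiv (2 * N), by
        have := Int.bmod_add_bdiv d (2 * N)
        push_cast at this
        linarith⟩
    have hk' : (d : ℝ) = ((d.bmod (2 * N) : ℤ) : ℝ) + 2 * N * k := by exact_mod_cast hk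
    rw [← Real.cos_add_int_mul_two_pi ((d.bmod (2 * N) : ℤ) * _) (k * α)]
    congr 1
    rw [hk']
    push_cast
    field_simp

/-- The interpolation error of `cos (d θ)` is at most `2`, and vanishes for `|d| ≤ N`. -/
theorem abs_cos_sub_sum_cos_mul_chebP_le {N : ℕ} (hN : 1 ≤ N) (d : ℤ) (θ : ℝ) :
    |Real.cos (d * θ) - ∑ α ∈ Finset.range (N + 1), Real.cos (d * (Real.pi * α / N)) *
      chebP N α ((Real.cos θ + 1) / 2)| ≤ if d.natAbs ≤ N then 0 else 2 := by
  split_ifs with hd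
  · rw [sum_cos_mul_chebP hN hd, sub_self, abs_zero]
  · obtain ⟨m, hm, hcos⟩ := exists_cos_alias hN d
    simp_rw [hcos]
    rw [sum_cos_mul_chebP hN hm]
    have h1 := abs_le.1 (Real.abs_cos_le_one (d * θ))
    have h2 := abs_le.1 (Real.abs_cos_le_one (m * θ))
    exact abs_le.2 ⟨by linarith, by linarith⟩

theorem hasSum_tail_geometric {r : ℝ} (hr0 : 0 ≤ r) (hr1 : r < 1) (N : ℕ) :
    HasSum (fun p : ℕ × ℕ => if p.1 + N < p.2 then r ^ (p.1 + p.2) else 0)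
      (r ^ (N + 1) * ((1 - r ^ 2)⁻¹ * (1 - r)⁻¹)) := by
  have hr2 : r ^ 2 < 1 := by nlinarith
  have hinj : Function.Injective fun p : ℕ × ℕ => (p.1, p.1 + N + 1 + p.2) := by
    rintro ⟨a, b⟩ ⟨c, d⟩ h
    simp only [Prod.mk.injEq] at h ⊢
    omega
  rw [← hinj.hasSum_iff]
  · have h1 := hasSum_geometric_of_lt_one (sq_nonneg r) hr2
    have h2 := hasSum_geometric_of_lt_one hr0 hr1
    have h3 := (h1.mul h2 (h1.summable.mul_of_nonneg h2.summable
      (fun _ => by positivity) (fun _ => by positivity))).mul_left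
      (r ^ (N + 1))
    convert! h3 using 1
    funext p
    simp only [Function.comp_apply]
    rw [if_pos (by omega)]
    ring
  · rintro ⟨a, b⟩ hp
    refine if_neg fun hlt => hp ⟨(a, b - (a + N + 1)), ?_⟩
    simp only [Prod.mk.injEq, true_and] at hlt ⊢
    omega

/-- Interpolation error of `|1 + r e^{iθ}|` as a function of `cos θ`. -/
theorem abs_norm_one_add_exp_sub_interpolant_le {N : ℕ} (hN : 1 ≤ N) {r : ℝ} (hr0 : 0 ≤ r)
    (hr1 : r < 1) (θ : ℝ) :
    |‖1 + r * Complex.exp (θ * Complex.I)‖ - ∑ α ∈ Finset.range (N + 1),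
      ‖1 + r * Complex.exp (((Real.pi * α / N : ℝ) : ℂ) * Complex.I)‖ *
        chebP N α ((Real.cos θ + 1) / 2)| ≤
      4 * (r ^ (N + 1) * ((1 - r ^ 2)⁻¹ * (1 - r)⁻¹)) := by
  have hE := (hasSum_norm_one_add_exp hr0 hr1 θ).sub
    (hasSum_sum fun α (_ : α ∈ Finset.range (N + 1)) =>
      (hasSum_norm_one_add_exp hr0 hr1 (Real.pi * α / N)).mul_right
        (chebP N α ((Real.cos θ + 1) / 2)))
  have ht := hasSum_tail_geometric hr0 hr1 N
  have ht' := (Equiv.prodComm ℕ ℕ).hasSum_iff.2 ht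
  have hB := (ht.add ht').mul_left 2
  rw [← hE.tsum_eq, ← Real.norm_eq_abs]
  refine (tsum_of_norm_bounded hB fun p => ?_).trans_eq (by ring)
  have hfac : ∀ w : ℝ, w * Real.cos (((p.1 - p.2 : ℤ) : ℝ) * θ) -
      ∑ α ∈ Finset.range (N + 1), w * Real.cos (((p.1 - p.2 : ℤ) : ℝ) * (Real.pi * α / N)) *
        chebP N α ((Real.cos θ + 1) / 2) =
      w * (Real.cos (((p.1 - p.2 : ℤ) : ℝ) * θ) -
      ∑ α ∈ Finset.range (N + 1), Real.cos (((p.1 - p.2 : ℤ) : ℝ) * (Real.pi * α / N)) *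
        chebP N α ((Real.cos θ + 1) / 2)) := by
    intro w
    rw [mul_sub, Finset.mul_sum]
    simp only [mul_assoc]
  rw [hfac, Real.norm_eq_abs, abs_mul, abs_mul, abs_mul, abs_of_nonneg (pow_nonneg hr0 _)]
  have hw : |Ring.choose (1 / 2 : ℝ) p.1| * |Ring.choose (1 / 2 : ℝ) p.2| * r ^ (p.1 + p.2) ≤
      r ^ (p.1 + p.2) :=
    mul_le_of_le_one_left (pow_nonneg hr0 _)
      (mul_le_one₀ (abs_choose_half_le_one _) (abs_nonneg _) (abs_choose_half_le_one _))
  refine (mul_le_mul hw (abs_cos_sub_sum_cos_mul_chebP_le hN _ θ) (abs_nonneg _)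
    (pow_nonneg hr0 _)).trans ?_
  change r ^ (p.1 + p.2) * (if (p.1 - p.2 : ℤ).natAbs ≤ N then 0 else 2) ≤
    2 * ((if p.1 + N < p.2 then r ^ (p.1 + p.2) else 0) +
      if p.2 + N < p.1 then r ^ (p.2 + p.1) else 0)
  rw [add_comm p.2 p.1]
  have hpow := pow_nonneg hr0 (p.1 + p.2)
  split_ifs <;> first | omega | linarith

/-- `√(1/2 + v/2)` at `v = (cos θ + 1)/2` as a multiple of `|1 + r e^{iθ}|`, `r = 3 - 2√2`. -/
theorem sqrt_eq_mul_norm_one_add_exp (θ : ℝ) :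
    Real.sqrt (1 / 2 + (Real.cos θ + 1) / 2 / 2) =
      (2 + Real.sqrt 2) / 4 *
        ‖1 + ((3 - 2 * Real.sqrt 2 : ℝ) : ℂ) * Complex.exp (θ * Complex.I)‖ := by
  have h2 : Real.sqrt 2 ^ 2 = 2 := Real.sq_sqrt (by norm_num)
  set s := Real.sqrt 2 with hs
  have hs0 : 0 ≤ s := Real.sqrt_nonneg 2
  set z : ℂ := 1 + ((3 - 2 * s : ℝ) : ℂ) * Complex.exp (θ * Complex.I) with hz
  have hn : ‖z‖ ^ 2 = 1 + 2 * (3 - 2 * s) * Real.cos θ + (3 - 2 * s) ^ 2 := by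
    rw [← Complex.normSq_eq_norm_sq, Complex.normSq_apply, hz]
    simp only [Complex.add_re, Complex.add_im, Complex.one_re, Complex.one_im,
      Complex.re_ofReal_mul, Complex.im_ofReal_mul, Complex.exp_ofReal_mul_I_re,
      Complex.exp_ofReal_mul_I_im]
    linear_combination (3 - 2 * s) ^ 2 * Real.sin_sq_add_cos_sq θ
  rw [← Real.sqrt_sq (by positivity : 0 ≤ (2 + s) / 4 * ‖z‖), mul_pow, hn]
  congr 1
  have h3 : s ^ 3 = 2 * s := by rw [pow_succ, h2]
  have h4 : s ^ 4 = 4 := by rw [show s ^ 4 = (s ^ 2) ^ 2 by ring, h2]; norm_num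
  ring_nf
  rw [h2, h3, h4]
  ring

/-- the `(N+1)`-point Chebyshev–Lobatto interpolation error of the square
root function on the interval `[1/2, 1]` is bounded by `2√6 (3+2√2)^{-N}/(2+2√2)`, and
in particular by `1.015 × (5.828)^{-N}`. -/
theorem stmt17 (N : ℕ) (hN : 1 ≤ N) :
    ∀ v ∈ Set.Icc (0 : ℝ) 1,
      |Real.sqrt (1 / 2 + v / 2) -
          ∑ α ∈ Finset.range (N + 1),
            Real.sqrt (1 / 2 + chebNode N α / 2) * chebP N α v|
        ≤ 2 * Real.sqrt 6 * (3 + 2 * Real.sqrt 2) ^ (-(N : ℤ)) / (2 + 2 * Real.sqrt 2) ∧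
      |Real.sqrt (1 / 2 + v / 2) -
          ∑ α ∈ Finset.range (N + 1),
            Real.sqrt (1 / 2 + chebNode N α / 2) * chebP N α v|
        ≤ 1.015 * (5.828 : ℝ) ^ (-(N : ℤ)) := by
  intro v hv
  set s := Real.sqrt 2 with hs
  have h2 : s ^ 2 = 2 := Real.sq_sqrt (by norm_num)
  have hs1 : 1.4142 < s := Real.lt_sqrt_of_sq_lt (by norm_num)
  have hs2 : s < 1.4143 := (Real.sqrt_lt' (by norm_num)).2 (by norm_num)
  have h61 : 2.4494 < Real.sqrt 6 := Real.lt_sqrt_of_sq_lt (by norm_num)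
  have h62 : Real.sqrt 6 < 2.4495 := (Real.sqrt_lt' (by norm_num)).2 (by norm_num)
  set θ := Real.arccos (2 * v - 1) with hθ
  have hvθ : v = (Real.cos θ + 1) / 2 := by
    rw [hθ, Real.cos_arccos (by linarith [hv.1]) (by linarith [hv.2])]
    ring
  have hmain := abs_norm_one_add_exp_sub_interpolant_le hN (r := 3 - 2 * s)
    (by linarith) (by linarith) θ
  have hinv : (3 + 2 * s)⁻¹ = 3 - 2 * s :=
    inv_eq_of_mul_eq_one_right (by nlinarith)
  have hpow : (3 + 2 * s) ^ (-(N : ℤ)) = (3 - 2 * s) ^ N := by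
    rw [zpow_neg, zpow_natCast, ← inv_pow, hinv]
  have hfirst : |Real.sqrt (1 / 2 + v / 2) -
          ∑ α ∈ Finset.range (N + 1),
            Real.sqrt (1 / 2 + chebNode N α / 2) * chebP N α v|
        ≤ 2 * Real.sqrt 6 * (3 + 2 * s) ^ (-(N : ℤ)) / (2 + 2 * s) := by
    simp only [hvθ, chebNode, sqrt_eq_mul_norm_one_add_exp, mul_assoc]
    rw [← Finset.mul_sum, ← mul_sub, abs_mul, abs_of_pos (by positivity), ← hs]
    refine (mul_le_mul_of_nonneg_left hmain (by positivity)).trans ?_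
    rw [hpow, pow_succ]
    have hr : 0 ≤ (3 - 2 * s) ^ N := pow_nonneg (by linarith) N
    have hq : (3 - 2 * s) * (1 - (3 - 2 * s))⁻¹ = (2 + 2 * s)⁻¹ := by
      rw [← div_eq_mul_inv, div_eq_iff (by linarith), inv_mul_eq_div, eq_div_iff (by linarith)]
      nlinarith
    have hc : (2 + s) * (1 - (3 - 2 * s) ^ 2)⁻¹ ≤ 2 * Real.sqrt 6 := by
      rw [← div_eq_mul_inv, div_le_iff₀ (by nlinarith)]
      nlinarith
    calc (2 + s) / 4 * (4 * ((3 - 2 * s) ^ N * (3 - 2 * s) *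
          ((1 - (3 - 2 * s) ^ 2)⁻¹ * (1 - (3 - 2 * s))⁻¹)))
        = ((2 + s) * (1 - (3 - 2 * s) ^ 2)⁻¹) * ((3 - 2 * s) ^ N *
          ((3 - 2 * s) * (1 - (3 - 2 * s))⁻¹)) := by ring
      _ ≤ (2 * Real.sqrt 6) * ((3 - 2 * s) ^ N * (2 + 2 * s)⁻¹) := by
        rw [hq]
        gcongr
      _ = _ := by ring
  refine ⟨hfirst, hfirst.trans ?_⟩
  rw [mul_div_right_comm, zpow_neg, zpow_neg, zpow_natCast, zpow_natCast]
  gcongr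
  · rw [div_le_iff₀ (by positivity)]
    norm_num at *
    linarith
  · linarith
end
end

section
/- Let ρ > 1, let m ≥ 0 be an integer, and set ρ_m := max(ρ, 2^m (ρ−1)²/ρ). Then for every u ∈ [0, 1 − 2^{−m}], the shifted and scaled Bernstein ellipse is contained in the reference one: {u + 2^{−m}·(z+1)/2 : z ∈ E_{ρ_m}} ⊆ {(w+1)/2 : w ∈ E_ρ}. -/
noncomputable section

/-- The Bernstein ellipse `E_ρ`, with semi-axes `a_ρ = (ρ+ρ⁻¹)/2` and `b_ρ = (ρ-ρ⁻¹)/2`. -/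
def bernsteinEllipse (ρ : ℝ) : Set ℂ :=
  {z : ℂ | (z.re / ((ρ + ρ⁻¹) / 2)) ^ 2 + (z.im / ((ρ - ρ⁻¹) / 2)) ^ 2 ≤ 1}

/-- Focal description of the Bernstein ellipse: its foci are `±1` and its major axis is `ρ + ρ⁻¹`. -/
theorem mem_bernsteinEllipse_iff {ρ : ℝ} (hρ : 1 < ρ) (z : ℂ) :
    z ∈ bernsteinEllipse ρ ↔ ‖z - 1‖ + ‖z + 1‖ ≤ ρ + ρ⁻¹ := by
  have hρ0 : 0 < ρ := by linarith
  have hinv : ρ * ρ⁻¹ = 1 := mul_inv_cancel₀ hρ0.ne'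
  have hinv1 : ρ⁻¹ < 1 := inv_lt_one_of_one_lt₀ hρ
  have hinv0 : 0 < ρ⁻¹ := inv_pos.mpr hρ0
  obtain ⟨a, ha⟩ : ∃ a, a = (ρ + ρ⁻¹) / 2 := ⟨_, rfl⟩
  obtain ⟨b, hb⟩ : ∃ b, b = (ρ - ρ⁻¹) / 2 := ⟨_, rfl⟩
  have hb0 : 0 < b := by linarith
  have ha0 : 0 < a := by linarith
  have hab : b ^ 2 = a ^ 2 - 1 := by rw [ha, hb]; linear_combination -hinv
  have ha1 : 1 < a := by nlinarith [pow_pos hb0 2]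
  have hmem : z ∈ bernsteinEllipse ρ ↔ (z.re / a) ^ 2 + (z.im / b) ^ 2 ≤ 1 := by
    rw [ha, hb]; rfl
  have hsum : ρ + ρ⁻¹ = 2 * a := by rw [ha]; ring
  have hp : ‖z - 1‖ ^ 2 = (z.re - 1) ^ 2 + z.im ^ 2 := by
    rw [Complex.sq_norm, Complex.normSq_apply]; simp; ring
  have hq : ‖z + 1‖ ^ 2 = (z.re + 1) ^ 2 + z.im ^ 2 := by
    rw [Complex.sq_norm, Complex.normSq_apply]; simp; ring
  have hD : |‖z + 1‖ - ‖z - 1‖| ≤ 2 := by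
    calc |‖z + 1‖ - ‖z - 1‖| ≤ ‖(z + 1) - (z - 1)‖ := abs_norm_sub_norm_le _ _
      _ = 2 := by rw [show (z + 1) - (z - 1) = 2 by ring]; simp
  have hp0 := norm_nonneg (z - 1)
  have hq0 := norm_nonneg (z + 1)
  rw [hmem, hsum]
  generalize ‖z - 1‖ = p at *
  generalize ‖z + 1‖ = q at *
  have hD2 : (q - p) ^ 2 < (2 * a) ^ 2 := by
    rw [sq_lt_sq, abs_of_pos (show 0 < 2 * a by linarith)]
    linarith
  have hfac : ((2 * a) ^ 2 - (p + q) ^ 2) * ((2 * a) ^ 2 - (q - p) ^ 2) =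
      16 * (a ^ 2 * b ^ 2 - (z.re ^ 2 * b ^ 2 + z.im ^ 2 * a ^ 2)) := by
    have h₁ : (p + q) * (q - p) = 4 * z.re := by linear_combination hq - hp
    have h₂ : (p + q) ^ 2 + (q - p) ^ 2 = 4 * (z.re ^ 2 + z.im ^ 2 + 1) := by
      linear_combination 2 * hp + 2 * hq
    rw [hab]
    linear_combination ((p + q) * (q - p) + 4 * z.re) * h₁ - 4 * a ^ 2 * h₂
  have hell : (z.re / a) ^ 2 + (z.im / b) ^ 2 ≤ 1 ↔
      0 ≤ a ^ 2 * b ^ 2 - (z.re ^ 2 * b ^ 2 + z.im ^ 2 * a ^ 2) := by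
    rw [div_pow, div_pow, div_add_div _ _ (by positivity) (by positivity),
      div_le_one (by positivity), sub_nonneg, mul_comm (a ^ 2) (z.im ^ 2)]
  rw [hell, ← sq_le_sq₀ (by linarith : 0 ≤ p + q) (by linarith : 0 ≤ 2 * a),
    ← sub_nonneg (b := (p + q) ^ 2),
    ← mul_nonneg_iff_of_pos_right (b := (2 * a) ^ 2 - (p + q) ^ 2) (sub_pos.mpr hD2), hfac]
  constructor <;> intro h <;> linarith

/-- A sufficient condition for a scaled and shifted Bernstein ellipse to lie in another one, when the
scaling and shift map `[-1, 1]` into itself. -/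
theorem mul_add_mem_bernsteinEllipse {ρ σ s t : ℝ} (hρ : 1 < ρ) (hσ : 1 < σ) (hs : 0 ≤ s)
    (ht : |t| ≤ 1 - s) (h : s * (σ + σ⁻¹ - 2) ≤ ρ + ρ⁻¹ - 2) {z : ℂ}
    (hz : z ∈ bernsteinEllipse σ) : (s : ℂ) * z + t ∈ bernsteinEllipse ρ := by
  rw [mem_bernsteinEllipse_iff hσ] at hz
  rw [mem_bernsteinEllipse_iff hρ]
  obtain ⟨ht₁, ht₂⟩ := abs_le.mp ht
  have hm : ‖(s : ℂ) * z + t - 1‖ ≤ s * ‖z - 1‖ + (1 - s - t) := by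
    calc ‖(s : ℂ) * z + t - 1‖ = ‖(s : ℂ) * (z - 1) + ((s + t - 1 : ℝ) : ℂ)‖ := by
          push_cast; ring_nf
      _ ≤ ‖(s : ℂ) * (z - 1)‖ + ‖((s + t - 1 : ℝ) : ℂ)‖ := norm_add_le _ _
      _ = s * ‖z - 1‖ + (1 - s - t) := by
          rw [norm_mul, Complex.norm_of_nonneg hs, Complex.norm_real, Real.norm_eq_abs,
            abs_of_nonpos (by linarith)]
          ring
  have hp : ‖(s : ℂ) * z + t + 1‖ ≤ s * ‖z + 1‖ + (1 - s + t) := by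
    calc ‖(s : ℂ) * z + t + 1‖ = ‖(s : ℂ) * (z + 1) + ((1 - s + t : ℝ) : ℂ)‖ := by
          push_cast; ring_nf
      _ ≤ ‖(s : ℂ) * (z + 1)‖ + ‖((1 - s + t : ℝ) : ℂ)‖ := norm_add_le _ _
      _ = s * ‖z + 1‖ + (1 - s + t) := by
          rw [norm_mul, Complex.norm_of_nonneg hs, Complex.norm_of_nonneg (by linarith)]
  nlinarith [mul_le_mul_of_nonneg_left hz hs]

/-- for `ρ > 1`, `m ≥ 0`, `ρ_m := max(ρ, 2^m (ρ-1)²/ρ)`, and any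
`u ∈ [0, 1 - 2^{-m}]`, the shifted and scaled Bernstein ellipse
`u + 2^{-m} (E_{ρ_m} + 1)/2` is contained in `(E_ρ + 1)/2`. -/
theorem stmt18 (ρ : ℝ) (hρ : 1 < ρ) (m : ℕ)
    (u : ℝ) (hu : u ∈ Set.Icc (0 : ℝ) (1 - (2 : ℝ) ^ (-(m : ℤ)))) :
    (fun z : ℂ => (u : ℂ) + (2 : ℂ) ^ (-(m : ℤ)) * (z + 1) / 2) ''
        bernsteinEllipse (max ρ (2 ^ m * (ρ - 1) ^ 2 / ρ))
      ⊆ (fun w : ℂ => (w + 1) / 2) '' bernsteinEllipse ρ := by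
  rintro _ ⟨z, hz, rfl⟩
  have hρ0 : 0 < ρ := by linarith
  obtain ⟨s, hs⟩ : ∃ s : ℝ, s = (2 : ℝ) ^ (-(m : ℤ)) := ⟨_, rfl⟩
  have hsinv : s = ((2 : ℝ) ^ m)⁻¹ := by rw [hs, zpow_neg, zpow_natCast]
  have hsC : (2 : ℂ) ^ (-(m : ℤ)) = (s : ℂ) := by rw [hs]; push_cast; rfl
  have hs0 : 0 < s := by rw [hs]; positivity
  have hs1 : s ≤ 1 := by rw [hsinv]; exact inv_le_one_of_one_le₀ (one_le_pow₀ one_le_two)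
  obtain ⟨hu₀, hu₁⟩ := hu
  rw [← hs] at hu₁
  have hσ : 1 < max ρ (2 ^ m * (ρ - 1) ^ 2 / ρ) := lt_max_of_lt_left hρ
  have hρρ : ρ + ρ⁻¹ - 2 = (ρ - 1) ^ 2 / ρ := by field_simp; ring
  have hscale : s * (max ρ (2 ^ m * (ρ - 1) ^ 2 / ρ) + (max ρ (2 ^ m * (ρ - 1) ^ 2 / ρ))⁻¹ - 2)
      ≤ ρ + ρ⁻¹ - 2 := by
    rcases max_cases ρ (2 ^ m * (ρ - 1) ^ 2 / ρ) with ⟨h, -⟩ | ⟨h, -⟩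
    · rw [h]
      refine mul_le_of_le_one_left ?_ hs1
      rw [hρρ]
      positivity
    · have hinv := inv_lt_one_of_one_lt₀ hσ
      calc _ ≤ s * max ρ (2 ^ m * (ρ - 1) ^ 2 / ρ) :=
            mul_le_mul_of_nonneg_left (by linarith) hs0.le
        _ = ρ + ρ⁻¹ - 2 := by rw [h, hρρ, hsinv]; field_simp
  refine ⟨(s : ℂ) * z + ((2 * u + s - 1 : ℝ) : ℂ),
    mul_add_mem_bernsteinEllipse hρ hσ hs0.le (abs_le.mpr ⟨by linarith, by linarith⟩) hscale hz, ?_⟩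
  simp only [hsC]
  push_cast
  ring
end
end
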